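/- Let p be a prime, s ∈ ℤ_{≥1}, a ∈ ℤ_p ∖ ℤ_{≤0}, c ∈ 1+qW, and suppose a^{(r)} = a for some r > 0; put h(t) := Π_{i=0}^{r−1} F_{a^{(i)},…,a^{(i)}}(t)_{<p}. Then for every n ≥ 1 the image of F_{a,…,a}(t)_{<p^n} in R_n := (W/p^nW)[t, t^{−1}, h(t)^{−1}] is a unit; consequently the elements Ĝ^{(σ)}_{a,…,a}(t)_{<p^n} · (F_{a,…,a}(t)_{<p^n})^{−1} ∈ R_n are compatible under the reduction maps R_{n+1} → R_n and define an element of W⟨t, t^{−1}, h(t)^{−1}⟩ := lim←_n R_n, i.e. ℱ̂^{(σ)}_{a,…,a}(t) is a convergent function. -/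

import Mathlib

open scoped Classical

namespace HGP

/-- `𝔽̄_p`, an algebraic closure of the prime field `𝔽_p`. -/
abbrev Fbar (p : ℕ) [Fact p.Prime] : Type _ := AlgebraicClosure (ZMod p)

/-- `W = W(𝔽̄_p)`, the ring of Witt vectors of `𝔽̄_p`. -/
abbrev Wp (p : ℕ) [Fact p.Prime] : Type _ := WittVector p (Fbar p)

/-- `K = Frac W`. -/
abbrev Kp (p : ℕ) [Fact p.Prime] : Type _ := FractionRing (Wp p)

/-- The canonical embedding `ℤ_p = W(𝔽_p) → W(𝔽̄_p)`. -/
noncomputable def iota (p : ℕ) [Fact p.Prime] : ℤ_[p] →+* Wp p :=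
  (WittVector.map (algebraMap (ZMod p) (Fbar p))).comp (WittVector.equiv p).symm.toRingHom

/-- The canonical embedding `W → K`. -/
noncomputable def iotaK (p : ℕ) [Fact p.Prime] : Wp p →+* Kp p := algebraMap (Wp p) (Kp p)

/-- `l`: the unique integer in `{0,…,p−1}` with `a + l ≡ 0 mod p`. -/
noncomputable def dl (p : ℕ) [Fact p.Prime] (a : ℤ_[p]) : ℕ := (-a).appr 1

/-- `q := 4` if `p = 2` and `q := p` otherwise. -/
def qq (p : ℕ) : ℕ := if p = 2 then 4 else p

/-- `l′`: the unique integer in `{0,…,q−1}` with `a + l′ ≡ 0 mod q`. -/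
noncomputable def dl' (p : ℕ) [Fact p.Prime] (a : ℤ_[p]) : ℕ :=
  (-a).appr (if p = 2 then 2 else 1)

/-- `e := l′ − ⌊l′/p⌋`. -/
noncomputable def de (p : ℕ) [Fact p.Prime] (a : ℤ_[p]) : ℕ := dl' p a - dl' p a / p

/-- `a ∈ ℤ_p ∖ ℤ_{≤0}`, i.e. `a` is not a nonpositive rational integer. -/
def NotNonposInt (p : ℕ) [Fact p.Prime] (a : ℤ_[p]) : Prop := ∀ n : ℕ, a + (n : ℤ_[p]) ≠ 0

/-- `a′` is the Dwork prime of `a`, i.e. `p·a′ = a + l`. -/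
def IsDworkPrime (p : ℕ) [Fact p.Prime] (a a' : ℤ_[p]) : Prop :=
  (p : ℤ_[p]) * a' = a + (dl p a : ℤ_[p])

/-- `A k = ((a)_k / k!)^s ∈ ℤ_p`, characterized by `k!^s · A k = ((a)_k)^s`. -/
def IsHGCoeff (p : ℕ) [Fact p.Prime] (s : ℕ) (a : ℤ_[p]) (A : ℕ → ℤ_[p]) : Prop :=
  ∀ k : ℕ, (k.factorial : ℤ_[p]) ^ s * A k = ((ascPochhammer ℤ_[p] k).eval a) ^ s

/-- `f = (α ↦ c^α)` for `c ∈ 1 + pW`: `c^α` is uniquely characterized by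
`c^α ≡ c^{α_n} mod p^n W` for any natural approximation `α_n` of `α` mod `p^n`. -/
def IsCpow (p : ℕ) [Fact p.Prime] (c : Wp p) (f : ℤ_[p] → Wp p) : Prop :=
  ∀ (α : ℤ_[p]) (n : ℕ), f α - c ^ (α.appr n) ∈ Ideal.span {(p : Wp p) ^ n}

/-- The coefficients `B_k` of `Ĝ^{(σ)}_{a,…,a}(t)`, as elements of `K = Frac W`:
`B_k = (k+a)⁻¹ (A_k − (−1)^{se} A^{(1)}_{(k−l)/p} c^{(k−l)/p + a′})`. -/
noncomputable def BhatK (p : ℕ) [Fact p.Prime] (s : ℕ) (a a' : ℤ_[p]) (A A1 : ℕ → ℤ_[p])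
    (cpw : ℤ_[p] → Wp p) (k : ℕ) : Kp p :=
  ((k : Kp p) + iotaK p (iota p a))⁻¹ *
    (iotaK p (iota p (A k)) -
      (if dl p a ≤ k ∧ p ∣ (k - dl p a) then
        (-1 : Kp p) ^ (s * de p a) * iotaK p (iota p (A1 ((k - dl p a) / p))) *
          iotaK p (cpw ((((k - dl p a) / p : ℕ) : ℤ_[p]) + a'))
      else 0))

/-- `B : ℕ → W` is the coefficient function of `Ĝ^{(σ)}_{a,…,a}(t)`, characterized in `W` by
`(k+a)·B_k = A_k − (−1)^{se} A^{(1)}_{(k−l)/p} c^{(k−l)/p + a′}`. -/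
def IsBhat (p : ℕ) [Fact p.Prime] (s : ℕ) (a a' : ℤ_[p]) (A A1 : ℕ → ℤ_[p])
    (cpw : ℤ_[p] → Wp p) (B : ℕ → Wp p) : Prop :=
  ∀ k : ℕ, ((k : Wp p) + iota p a) * B k =
    iota p (A k) -
      (if dl p a ≤ k ∧ p ∣ (k - dl p a) then
        (-1 : Wp p) ^ (s * de p a) * iota p (A1 ((k - dl p a) / p)) *
          cpw ((((k - dl p a) / p : ℕ) : ℤ_[p]) + a')
      else 0)

/-- A function `ℕ → K` is Lipschitz: it takes values in `W` and
`p^m ∣ (n − n′)` implies `f n − f n′ ∈ p^m W`. -/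
def LipschitzSeq (p : ℕ) [Fact p.Prime] (f : ℕ → Kp p) : Prop :=
  (∀ n : ℕ, f n ∈ (iotaK p).range) ∧
    ∀ n n' m : ℕ, ((p : ℤ) ^ m ∣ (n : ℤ) - (n' : ℤ)) →
      ∃ w : Wp p, f n - f n' = (p : Kp p) ^ m * iotaK p w

/-- `L` is the `p`-adic limit of the sequence `s` in `W`. -/
def WLim (p : ℕ) [Fact p.Prime] (s : ℕ → Wp p) (L : Wp p) : Prop :=
  ∀ m : ℕ, ∃ M : ℕ, ∀ n ≥ M, L - s n ∈ Ideal.span {(p : Wp p) ^ m}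

/-- `{α}_k := Π_{1 ≤ i ≤ k, p ∤ (α+i−1)} (α+i−1)`. -/
noncomputable def curly (p : ℕ) [Fact p.Prime] (α : ℤ_[p]) (k : ℕ) : ℤ_[p] :=
  ∏ j ∈ Finset.range k, if (p : ℤ_[p]) ∣ (α + (j : ℤ_[p])) then 1 else (α + (j : ℤ_[p]))

/-- `W/p^n W`. -/
abbrev Qn (p : ℕ) [Fact p.Prime] (n : ℕ) := Wp p ⧸ Ideal.span {(p : Wp p) ^ n}

/-- Laurent polynomials over `W/p^n`, obtained from polynomials over `W`. -/
noncomputable def laurentOfPolyW (p : ℕ) [Fact p.Prime] (n : ℕ) :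
    Polynomial (Wp p) →+* LaurentPolynomial (Qn p n) :=
  (Polynomial.toLaurent).comp
    (Polynomial.mapRingHom (Ideal.Quotient.mk (Ideal.span {(p : Wp p) ^ n})))

/-- `R_n := (W/p^n)[t,t⁻¹, h(t)⁻¹]`, the localization of the Laurent polynomial ring
over `W/p^n` away from (the image of) `h`. -/
abbrev Rn (p : ℕ) [Fact p.Prime] (h : Polynomial (Wp p)) (n : ℕ) :=
  Localization.Away (laurentOfPolyW p n h)

/-- The canonical map from Laurent polynomials over `W/p^n` to `R_n`. -/
noncomputable def mkRn (p : ℕ) [Fact p.Prime] (h : Polynomial (Wp p)) (n : ℕ) :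
    LaurentPolynomial (Qn p n) →+* Rn p h n := algebraMap _ _

/-- The canonical map from polynomials over `W` to `R_n`. -/
noncomputable def toRn (p : ℕ) [Fact p.Prime] (h : Polynomial (Wp p)) (n : ℕ) :
    Polynomial (Wp p) →+* Rn p h n := (mkRn p h n).comp (laurentOfPolyW p n)



end HGP


namespace HGP

section generic

variable {R : Type*} [CommRing R]

theorem dvd_prod_sub_prod {ι : Type*} (M : R) (S : Finset ι) (f g : ι → R)
    (h : ∀ i ∈ S, M ∣ f i - g i) : M ∣ ∏ i ∈ S, f i - ∏ i ∈ S, g i := by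
  rw [← Ideal.mem_span_singleton, ← Ideal.Quotient.eq, map_prod, map_prod]
  refine Finset.prod_congr rfl fun i hi => ?_
  rw [Ideal.Quotient.eq, Ideal.mem_span_singleton]
  exact h i hi

theorem dvd_mul_sub_mul (M : R) {a b c d : R} (h1 : M ∣ a - b) (h2 : M ∣ c - d) :
    M ∣ a * c - b * d := by
  have : a * c - b * d = (a - b) * c + b * (c - d) := by ring
  rw [this]
  exact dvd_add (h1.mul_right _) (h2.mul_left _)

theorem dvd_pow_sub_pow' (M : R) {a b : R} (h1 : M ∣ a - b) (s : ℕ) :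
    M ∣ a ^ s - b ^ s := h1.trans (sub_dvd_pow_sub_pow a b s)

theorem dvd_sub_trans' {M a b c : R} (h1 : M ∣ a - b) (h2 : M ∣ b - c) : M ∣ a - c := by
  have := dvd_add h1 h2
  simpa using this

theorem dvd_sub_symm' {M a b : R} (h1 : M ∣ a - b) : M ∣ b - a := by
  rwa [dvd_sub_comm]

/-- The telescoping lemma. -/
theorem telescope (P : R) (p n δ : ℕ) (S : Finset ℕ) (g r : ℕ → R)
    (hr : ∀ j ∈ S, ∀ j' ∈ S, ∀ t, j ≡ j' [MOD p ^ t] → P ^ (t + δ) ∣ r j - r j')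
    (k : ℕ) (hk : k ≤ n)
    (hg : ∀ k', k < k' → k' ≤ n → ∀ κ, P ^ (n - k' + 1) ∣ ∑ j ∈ S with j % p ^ k' = κ, g j)
    (κ : ℕ) (hκ : κ ∈ S) :
    P ^ (n + δ) ∣ ∑ j ∈ S with j % p ^ k = κ % p ^ k, (r j - r κ) * g j := by
  induction hk using Nat.decreasingInduction generalizing κ with
  | self =>
    refine Finset.dvd_sum fun j hj => ?_
    rw [Finset.mem_filter] at hj
    exact (hr j hj.1 κ hκ n hj.2).mul_right _
  | of_succ k hk ih =>
    have ih' := ih (fun k' h1 h2 => hg k' (by omega) h2)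
    set S' := S.filter (fun j => j % p ^ k = κ % p ^ k) with hS'
    rw [← Finset.sum_fiberwise_of_maps_to (s := S') (t := S'.image (fun j => j % p ^ (k+1)))
      (g := fun j => j % p ^ (k+1)) (fun i hi => Finset.mem_image_of_mem _ hi)]
    refine Finset.dvd_sum fun b hb => ?_
    obtain ⟨x, hx, rfl⟩ := Finset.mem_image.1 hb
    rw [hS', Finset.mem_filter] at hx
    have key : (S'.filter fun j => j % p ^ (k+1) = x % p ^ (k+1)) =
        S.filter fun j => j % p ^ (k+1) = x % p ^ (k+1) := by
      ext j
      simp only [hS', Finset.mem_filter]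
      constructor
      · rintro ⟨⟨h1, h2⟩, h3⟩; exact ⟨h1, h3⟩
      · rintro ⟨h1, h3⟩
        refine ⟨⟨h1, ?_⟩, h3⟩
        rw [← hx.2]
        exact Nat.ModEq.of_mul_right p (by rw [← pow_succ]; exact h3)
    rw [key]
    have e : ∑ j ∈ S with j % p ^ (k+1) = x % p ^ (k+1), (r j - r κ) * g j =
        ∑ j ∈ S with j % p ^ (k+1) = x % p ^ (k+1), (r j - r x) * g j +
        (r x - r κ) * ∑ j ∈ S with j % p ^ (k+1) = x % p ^ (k+1), g j := by
      rw [Finset.mul_sum, ← Finset.sum_add_distrib]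
      exact Finset.sum_congr rfl fun j _ => by ring
    rw [e]
    refine dvd_add (ih' x hx.1) ?_
    have h1 := hr x hx.1 κ hκ k hx.2
    have h2 := hg (k+1) (by omega) (by omega) (x % p ^ (k+1))
    have : n + δ = (k + δ) + (n - (k+1) + 1) := by omega
    rw [this, pow_add]
    exact mul_dvd_mul h1 h2

/-- window lemma, natural shift -/
theorem window_nat (L : ℕ) (M : R) (f : R → R)
    (hf : ∀ b, M ∣ f (b + L) - f b) (b : R) (k : ℕ) :
    M ∣ ∏ j ∈ Finset.range L, f (b + k + j) - ∏ j ∈ Finset.range L, f (b + j) := by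
  induction k with
  | zero => simp
  | succ k ih =>
    refine dvd_sub_trans' ?_ ih
    rcases Nat.eq_zero_or_pos L with rfl | hL
    · simp
    obtain ⟨m, rfl⟩ : ∃ m, L = m + 1 := ⟨L - 1, by omega⟩
    rw [Finset.prod_range_succ, Finset.prod_range_succ']
    have : ∀ x : ℕ, f (b + ((k + 1 : ℕ) : R) + x) = f (b + k + ((x + 1 : ℕ) : R)) := by
      intro x; congr 1; push_cast; ring
    simp only [this]
    refine dvd_mul_sub_mul _ (by simp) ?_
    have := hf (b + k)
    convert this using 3
    all_goals push_cast
    all_goals ring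

end generic

section padic

variable (p : ℕ) [hp : Fact p.Prime]

theorem nat_dvd_of_modEq {R : Type*} [CommRing R] {m k k' : ℕ} (h : k ≡ k' [MOD m]) :
    (m : R) ∣ (k : R) - k' := by
  have h1 : (m : ℤ) ∣ (k' : ℤ) - k := (Nat.modEq_iff_dvd).1 h
  obtain ⟨w, hw⟩ := h1
  refine ⟨-(w : R), ?_⟩
  have h2 : ((k' : ℤ) : R) - ((k : ℤ) : R) = ((m : ℤ) : R) * (w : R) := by exact_mod_cast congrArg (Int.cast : ℤ → R) hw
  push_cast at h2
  linear_combination -h2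

theorem pow_dvd_of_modEq {R : Type*} [CommRing R] {n k k' : ℕ} (h : k ≡ k' [MOD p ^ n]) :
    (p : R) ^ n ∣ (k : R) - k' := by
  have := nat_dvd_of_modEq (R := R) h
  push_cast at this
  exact this

/-- the window lemma in `ℤ_p` -/
theorem window (n : ℕ) (M : ℤ_[p]) (f : ℤ_[p] → ℤ_[p])
    (hf : ∀ b b', (p : ℤ_[p]) ^ n ∣ b - b' → M ∣ f b - f b') (b b' : ℤ_[p]) :
    M ∣ ∏ j ∈ Finset.range (p ^ n), f (b + j) - ∏ j ∈ Finset.range (p ^ n), f (b' + j) := by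
  have h1 := window_nat (p ^ n) M f (fun b => hf _ _ (by simp)) b' ((b - b').appr n)
  refine dvd_sub_trans' (dvd_prod_sub_prod _ _ _ _ fun j _ => hf _ _ ?_) h1
  have := PadicInt.appr_spec n (b - b')
  rw [Ideal.mem_span_singleton] at this
  convert this using 1
  ring

theorem not_dvd_isUnit {x : ℤ_[p]} (h : ¬ (p : ℤ_[p]) ∣ x) : IsUnit x := by
  rw [PadicInt.isUnit_iff]
  rw [← PadicInt.norm_lt_one_iff_dvd, not_lt] at h
  exact le_antisymm (PadicInt.norm_le_one x) h

theorem p_not_unit : ¬ IsUnit (p : ℤ_[p]) := by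
  rw [PadicInt.isUnit_iff]
  have := (PadicInt.norm_lt_one_iff_dvd (p : ℤ_[p])).2 dvd_rfl
  exact this.ne

theorem isUnit_iff_not_dvd {x : ℤ_[p]} : IsUnit x ↔ ¬ (p : ℤ_[p]) ∣ x :=
  ⟨fun h h2 => p_not_unit p (isUnit_of_dvd_unit h2 h), not_dvd_isUnit p⟩

theorem p_ne : (p : ℤ_[p]) ≠ 0 := by exact_mod_cast hp.out.ne_zero

/-- the `p`-free part -/
noncomputable def f0 (x : ℤ_[p]) : ℤ_[p] := if (p : ℤ_[p]) ∣ x then 1 else x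

theorem f0_isUnit (x : ℤ_[p]) : IsUnit (f0 p x) := by
  unfold f0; split_ifs with h
  · exact isUnit_one
  · exact not_dvd_isUnit p h

theorem dvd_iff_of_dvd_sub {x y : ℤ_[p]} {n : ℕ} (hn : n ≠ 0) (h : (p : ℤ_[p]) ^ n ∣ x - y) :
    (p : ℤ_[p]) ∣ x ↔ (p : ℤ_[p]) ∣ y := by
  have := (dvd_pow_self (p : ℤ_[p]) hn).trans h
  constructor
  · intro h1; have := dvd_sub h1 this; simpa using this
  · intro h1; have := dvd_add this h1; simpa using this

theorem f0_congr (n : ℕ) (b b' : ℤ_[p]) (h : (p : ℤ_[p]) ^ n ∣ b - b') :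
    (p : ℤ_[p]) ^ n ∣ f0 p b - f0 p b' := by
  rcases eq_or_ne n 0 with rfl | hn
  · simp
  unfold f0
  rw [dvd_iff_of_dvd_sub p hn h]
  split_ifs
  · simp
  · exact h

theorem curly_eq (a : ℤ_[p]) (k : ℕ) : curly p a k = ∏ j ∈ Finset.range k, f0 p (a + j) := rfl

theorem curly_isUnit (a : ℤ_[p]) (k : ℕ) : IsUnit (curly p a k) := by
  rw [curly_eq, IsUnit.prod_iff]
  exact fun _ _ => f0_isUnit p _

theorem curly_add (a : ℤ_[p]) (k m : ℕ) :
    curly p a (k + m) = curly p a k * curly p (a + k) m := by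
  simp only [curly_eq, Finset.prod_range_add]
  congr 1
  refine Finset.prod_congr rfl fun j _ => ?_
  push_cast; rw [add_assoc]

/-- unit inverse (zero on non-units) -/
noncomputable def iv (x : ℤ_[p]) : ℤ_[p] := Ring.inverse x

theorem iv_mul {x : ℤ_[p]} (h : IsUnit x) : x * iv p x = 1 := Ring.mul_inverse_cancel x h

theorem iv_of_dvd {x : ℤ_[p]} (h : (p : ℤ_[p]) ∣ x) : iv p x = 0 :=
  Ring.inverse_non_unit x (fun h2 => (isUnit_iff_not_dvd p).1 h2 h)

theorem iv_congr (n : ℕ) (b b' : ℤ_[p]) (h : (p : ℤ_[p]) ^ n ∣ b - b') :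
    (p : ℤ_[p]) ^ n ∣ iv p b - iv p b' := by
  rcases eq_or_ne n 0 with rfl | hn
  · simp
  by_cases h1 : (p : ℤ_[p]) ∣ b
  · rw [iv_of_dvd p h1, iv_of_dvd p ((dvd_iff_of_dvd_sub p hn h).1 h1)]; simp
  · have h2 := iv_mul p (not_dvd_isUnit p h1)
    have h3 := iv_mul p (not_dvd_isUnit p (mt (dvd_iff_of_dvd_sub p hn h).2 h1))
    have : iv p b - iv p b' = (b - b') * (- (iv p b * iv p b')) := by
      linear_combination iv p b * (-h3)  + iv p b' * h2
    rw [this]; exact h.mul_right _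

theorem curly_ratio_step (a : ℤ_[p]) (n k : ℕ) :
    (p : ℤ_[p]) ^ n ∣ curly p a (k + p ^ n) * curly p 1 k - curly p a k * curly p 1 (k + p ^ n) := by
  rw [curly_add, curly_add]
  have := window p n ((p : ℤ_[p]) ^ n) (f0 p) (f0_congr p n) (a + k) (1 + k)
  rw [← curly_eq, ← curly_eq] at this
  obtain ⟨w, hw⟩ := this
  exact ⟨curly p a k * curly p 1 k * w, by linear_combination curly p a k * curly p 1 k * hw⟩

/-- step to Lipschitz -/
theorem lip_of_step {R : Type*} [CommRing R] (M : R) (m : ℕ) (Pr : ℕ → Prop)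
    (hPr : ∀ k, Pr k → Pr (k + m)) (f : ℕ → R)
    (h : ∀ k, Pr k → M ∣ f (k + m) - f k) (k k' : ℕ) (hk : Pr k) (hk' : Pr k')
    (hkk : k ≡ k' [MOD m]) : M ∣ f k - f k' := by
  have key : ∀ d k, Pr k → (Pr (k + m * d) ∧ M ∣ f (k + m * d) - f k) := by
    intro d
    induction d with
    | zero => intro k hk; simpa using hk
    | succ d ih =>
      intro k hk
      have h1 := ih k hk
      have e : k + m * (d + 1) = (k + m * d) + m := by ring
      rw [e]
      exact ⟨hPr _ h1.1, dvd_sub_trans' (h _ h1.1) h1.2⟩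
  wlog hle : k ≤ k' generalizing k k'
  · exact dvd_sub_symm' (this k' k hk' hk hkk.symm (by omega))
  obtain ⟨d, hd⟩ := (Nat.modEq_iff_dvd' hle).1 hkk
  have : k' = k + m * d := by omega
  rw [this]
  exact dvd_sub_symm' (key d k hk).2

theorem curly_ratio_lip (a : ℤ_[p]) (n k k' : ℕ) (h : k ≡ k' [MOD p ^ n]) :
    (p : ℤ_[p]) ^ n ∣ curly p a k * iv p (curly p 1 k) - curly p a k' * iv p (curly p 1 k') := by
  refine lip_of_step _ (p ^ n) (fun _ => True) (fun _ _ => trivial)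
    (fun k => curly p a k * iv p (curly p 1 k)) ?_ k k' trivial trivial h
  intro k _
  obtain ⟨w, hw⟩ := curly_ratio_step p a n k
  have h1 := iv_mul p (curly_isUnit p 1 k)
  have h2 := iv_mul p (curly_isUnit p 1 (k + p ^ n))
  refine ⟨w * iv p (curly p 1 k) * iv p (curly p 1 (k + p ^ n)), ?_⟩
  linear_combination iv p (curly p 1 k) * iv p (curly p 1 (k + p ^ n)) * hw
    - curly p a (k + p^n) * iv p (curly p 1 (k + p ^ n)) * h1 + curly p a k * iv p (curly p 1 k) * h2

/-- `p ∣ a + j ↔ j % p = l` -/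
theorem dvd_add_iff {a a' : ℤ_[p]} {l : ℕ} (hl : l < p) (h : (p : ℤ_[p]) * a' = a + l) (j : ℕ) :
    (p : ℤ_[p]) ∣ a + j ↔ j % p = l := by
  have h1 : (p : ℤ_[p]) ∣ a + j ↔ (p : ℤ_[p]) ∣ (((j : ℤ) - l : ℤ) : ℤ_[p]) := by
    have : a + j = p * a' + (((j : ℤ) - l : ℤ) : ℤ_[p]) := by rw [h]; push_cast; ring
    rw [this]
    exact dvd_add_right (dvd_mul_right _ _)
  rw [h1, ← PadicInt.norm_lt_one_iff_dvd, PadicInt.norm_intCast_lt_one_iff,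
    ← Nat.modEq_iff_dvd, Nat.ModEq, Nat.mod_eq_of_lt hl, eq_comm]

theorem poch_decomp {a a' : ℤ_[p]} {l : ℕ} (hl : l < p) (h : (p : ℤ_[p]) * a' = a + l) (k : ℕ) :
    (ascPochhammer ℤ_[p] k).eval a = curly p a k * (p : ℤ_[p]) ^ (k / p) *
      (ascPochhammer ℤ_[p] (k / p)).eval a' *
      (if l < k % p then (p : ℤ_[p]) * (a' + (k / p : ℕ)) else 1) := by
  have hpos := hp.out.pos
  induction k with
  | zero => simp [curly]
  | succ k ih =>
    rw [ascPochhammer_succ_eval, ih, curly_add]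
    have hc : curly p (a + k) 1 = if k % p = l then 1 else a + k := by
      simp only [curly, Finset.prod_range_one, Nat.cast_zero, add_zero]
      simp only [dvd_add_iff p hl h k]
    rw [hc]
    have hd := Nat.div_add_mod k p
    have hlt := Nat.mod_lt k hpos
    have hak : a + (k : ℤ_[p]) = p * (a' + (k / p : ℕ)) + ((k % p : ℕ) : ℤ_[p]) - l := by
      have : (k : ℤ_[p]) = p * (k / p : ℕ) + (k % p : ℕ) := by exact_mod_cast hd.symm
      linear_combination -h + this
    set m := k / p
    set κ := k % p
    by_cases h2 : κ + 1 < p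
    · have h6 : k + 1 = (κ + 1) + p * m := by omega
      have e1 : (k + 1) / p = m := by
        rw [h6, Nat.add_mul_div_left _ _ hpos, Nat.div_eq_of_lt h2, zero_add]
      have e2 : (k + 1) % p = κ + 1 := by
        rw [h6, Nat.add_mul_mod_self_left, Nat.mod_eq_of_lt h2]
      rw [e1, e2]
      by_cases h3 : κ = l
      · rw [if_pos h3, if_neg (by omega), if_pos (by omega), hak, h3]; ring
      · rw [if_neg h3]
        by_cases h4 : l < κ
        · rw [if_pos h4, if_pos (by omega)]; ring
        · rw [if_neg h4, if_neg (by omega)]; ring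
    · have h5 : k + 1 = p * (m + 1) := by rw [mul_add]; omega
      have e1 : (k + 1) / p = m + 1 := by rw [h5, Nat.mul_div_cancel_left _ hpos]
      have e2 : (k + 1) % p = 0 := by rw [h5, Nat.mul_mod_right]
      rw [e1, e2, if_neg (Nat.not_lt_zero l), ascPochhammer_succ_eval]
      by_cases h3 : κ = l
      · rw [if_pos h3, if_neg (by omega), hak, h3]; ring
      · rw [if_neg h3, if_pos (by omega)]; ring

theorem fact_decomp (k : ℕ) :
    (k.factorial : ℤ_[p]) = curly p 1 k * (p : ℤ_[p]) ^ (k / p) * ((k / p).factorial : ℤ_[p]) := by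
  have hpos := hp.out.pos
  have h := poch_decomp p (a := 1) (a' := 1) (l := p - 1) (by omega)
    (by rw [Nat.cast_sub hpos]; push_cast; ring) k
  have hlt := Nat.mod_lt k hpos
  rw [if_neg (by omega), mul_one] at h
  simpa [ascPochhammer_eval_one] using h

theorem fact_ne (k : ℕ) : (k.factorial : ℤ_[p]) ≠ 0 := by exact_mod_cast k.factorial_ne_zero

theorem coeff_unique {s : ℕ} {a : ℤ_[p]} {A A' : ℕ → ℤ_[p]} (h : IsHGCoeff p s a A)
    (h' : IsHGCoeff p s a A') : A = A' := by
  funext k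
  exact mul_left_cancel₀ (pow_ne_zero s (fact_ne p k)) ((h k).trans (h' k).symm)

/-- the ratio function -/
theorem ratio_exact {s : ℕ} {a a' : ℤ_[p]} {l : ℕ} (hl : l < p) (h : (p : ℤ_[p]) * a' = a + l)
    {A A1 : ℕ → ℤ_[p]} (hA : IsHGCoeff p s a A) (hA1 : IsHGCoeff p s a' A1) (k : ℕ) :
    curly p 1 k ^ s * A k = A1 (k / p) * (curly p a k *
      (if l < k % p then (p : ℤ_[p]) * (a' + (k / p : ℕ)) else 1)) ^ s := by
  have h1 := hA k
  have h2 := hA1 (k / p)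
  rw [poch_decomp p hl h k, fact_decomp p k] at h1
  have hne : ((p : ℤ_[p]) ^ (k / p) * ((k / p).factorial : ℤ_[p])) ^ s ≠ 0 :=
    pow_ne_zero _ (mul_ne_zero (pow_ne_zero _ (p_ne p)) (fact_ne p _))
  refine mul_left_cancel₀ hne ?_
  simp only [mul_pow] at h1 ⊢
  linear_combination h1 - (curly p a k) ^ s * ((p : ℤ_[p]) ^ (k / p)) ^ s *
    (if l < k % p then (p : ℤ_[p]) * (a' + (k / p : ℕ)) else 1) ^ s * h2

theorem ratio {s : ℕ} {a a' : ℤ_[p]} {l : ℕ} (hl : l < p) (h : (p : ℤ_[p]) * a' = a + l)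
    {A A1 : ℕ → ℤ_[p]} (hA : IsHGCoeff p s a A) (hA1 : IsHGCoeff p s a' A1) :
    ∃ ρ : ℕ → ℤ_[p], (∀ k, A k = A1 (k / p) * ρ k) ∧
      ∀ n k k', n ≠ 0 → k ≡ k' [MOD p ^ n] → (p : ℤ_[p]) ^ n ∣ ρ k - ρ k' := by
  refine ⟨fun k => (curly p a k * iv p (curly p 1 k) *
    (if l < k % p then (p : ℤ_[p]) * (a' + (k / p : ℕ)) else 1)) ^ s, ?_, ?_⟩
  · intro k
    have h1 := ratio_exact p hl h hA hA1 k
    have h2 := iv_mul p (curly_isUnit p 1 k)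
    have h3 : (curly p 1 k) ^ s * (iv p (curly p 1 k)) ^ s = 1 := by rw [← mul_pow, h2, one_pow]
    simp only [mul_pow] at h1 ⊢
    linear_combination (iv p (curly p 1 k)) ^ s * h1 - A k * h3
  · intro n k k' hn hk
    refine dvd_pow_sub_pow' _ (dvd_mul_sub_mul _ (curly_ratio_lip p a n k k' hk) ?_) s
    have hm : k % p = k' % p := Nat.ModEq.of_dvd (dvd_pow_self p hn) hk
    rw [hm]
    split_ifs
    · have e : ∀ k : ℕ, (p : ℤ_[p]) * (a' + (k / p : ℕ)) = a + l + k - (k % p : ℕ) := by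
        intro k
        have : (k : ℤ_[p]) = p * (k / p : ℕ) + (k % p : ℕ) := by
          exact_mod_cast (Nat.div_add_mod k p).symm
        linear_combination h - this
      rw [e, e, hm]
      have := pow_dvd_of_modEq p (R := ℤ_[p]) hk
      convert this using 1
      ring
    · simp

end padic

end HGP


namespace HGP

section dwork

variable (p : ℕ) [hp : Fact p.Prime]

/-- index set: `j, N - j < p^n` -/
def SS (n N : ℕ) : Finset ℕ := (Finset.range (p ^ n)).filter (fun j => j ≤ N ∧ N - j < p ^ n)

theorem mem_SS {n N j : ℕ} : j ∈ SS p n N ↔ j < p ^ n ∧ j ≤ N ∧ N - j < p ^ n := by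
  simp [SS]

/-- Dwork's antisymmetric expression -/
noncomputable def gg (A : ℕ → ℤ_[p]) (n d N j : ℕ) : ℤ_[p] :=
  A (d * p ^ n + j) * A (N - j) - A (d * p ^ n + (N - j)) * A j

theorem SS_swap {R : Type*} [AddCommMonoid R] (n N : ℕ) (f : ℕ → R) :
    ∑ j ∈ SS p n N, f (N - j) = ∑ j ∈ SS p n N, f j := by
  refine Finset.sum_nbij' (fun j => N - j) (fun j => N - j) ?_ ?_ ?_ ?_ ?_
  · intro j hj; rw [mem_SS] at hj ⊢; omega
  · intro j hj; rw [mem_SS] at hj ⊢; omega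
  · intro j hj; rw [mem_SS] at hj; omega
  · intro j hj; rw [mem_SS] at hj; omega
  · intro j hj; rfl

theorem gg_total (A : ℕ → ℤ_[p]) (n d N : ℕ) : ∑ j ∈ SS p n N, gg p A n d N j = 0 := by
  have h := SS_swap p n N (fun j => A (d * p ^ n + j) * A (N - j))
  unfold gg
  rw [Finset.sum_sub_distrib, ← h, sub_eq_zero]
  refine Finset.sum_congr rfl fun j hj => ?_
  rw [mem_SS] at hj
  have : N - (N - j) = j := by omega
  rw [this]

theorem dwork (AF ρ : ℕ → ℕ → ℤ_[p]) (h1 : ∀ i k, AF i k = AF (i + 1) (k / p) * ρ i k)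
    (h2 : ∀ i n k k', n ≠ 0 → k ≡ k' [MOD p ^ n] → (p : ℤ_[p]) ^ n ∣ ρ i k - ρ i k') (n : ℕ) :
    ∀ i N d k κ, k ≤ n → (p : ℤ_[p]) ^ (n - k + 1) ∣
      ∑ j ∈ SS p n N with j % p ^ k = κ, gg p (AF i) n d N j := by
  have hpos := hp.out.pos
  have zero_case : ∀ n i N d κ, (p : ℤ_[p]) ^ (n + 1) ∣
      ∑ j ∈ SS p n N with j % p ^ 0 = κ, gg p (AF i) n d N j := by
    intro n i N d κ
    by_cases hκ : κ = 0
    · subst hκ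
      simp [Nat.mod_one, gg_total]
    · rw [Finset.filter_false_of_mem]
      · simp
      · intro j _; simp [Nat.mod_one]; omega
  induction n with
  | zero =>
    intro i N d k κ hk
    obtain rfl : k = 0 := by omega
    exact zero_case 0 i N d κ
  | succ n ih =>
    intro i N d k κ hk
    rcases k with _ | k
    · exact zero_case (n + 1) i N d κ
    rcases Finset.eq_empty_or_nonempty ((SS p (n+1) N).filter (fun j => j % p ^ (k+1) = κ)) with h | ⟨x, hx⟩
    · rw [h]; simp
    rw [Finset.mem_filter] at hx
    obtain ⟨hxS, rfl⟩ := hx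
    rw [mem_SS] at hxS
    obtain ⟨κ0, hκ0⟩ : ∃ κ0, κ0 = x % p := ⟨_, rfl⟩
    obtain ⟨x', hx'⟩ : ∃ x', x' = x / p := ⟨_, rfl⟩
    have hxd : x = κ0 + p * x' := by rw [hκ0, hx', Nat.mod_add_div]
    have hκlt : κ0 < p := hκ0 ▸ Nat.mod_lt _ hpos
    obtain ⟨ι0, hι0⟩ : ∃ ι0, ι0 = (N - κ0) % p := ⟨_, rfl⟩
    obtain ⟨N', hN'⟩ : ∃ N', N' = (N - κ0) / p := ⟨_, rfl⟩
    have hιlt : ι0 < p := hι0 ▸ Nat.mod_lt _ hpos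
    have hNd : N = κ0 + (ι0 + p * N') := by
      rw [hι0, hN', Nat.mod_add_div]; omega
    clear hκ0 hx' hι0 hN'
    have hdiv : ∀ c y, c < p → (c + p * y) / p = y := fun c y hc => by
      rw [Nat.add_mul_div_left _ _ hpos, Nat.div_eq_of_lt hc, zero_add]
    have hmod : ∀ c y, c < p → (c + p * y) % p = c := fun c y hc => by
      rw [Nat.add_mul_mod_self_left, Nat.mod_eq_of_lt hc]
    have hlt : ∀ c y m, c < p → (c + p * y < p ^ (m + 1) ↔ y < p ^ m) := fun c y m hc => by
      rw [pow_succ, ← Nat.div_lt_iff_lt_mul hpos, hdiv c y hc]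
    have hmodk : ∀ y, (κ0 + p * y) % p ^ (k+1) = κ0 + p * (y % p ^ k) := fun y => by
      rw [pow_succ', Nat.mod_mul, hdiv _ _ hκlt, hmod _ _ hκlt]
    have hsub : ∀ y, y ≤ N' → N - (κ0 + p * y) = ι0 + p * (N' - y) := fun y hy => by
      have := Nat.mul_le_mul_left p hy
      rw [Nat.mul_sub]; omega
    have hle : ∀ y, κ0 + p * y ≤ N → y ≤ N' := fun y hy => by
      by_contra hc
      have : p * (N' + 1) ≤ p * y := Nat.mul_le_mul_left p (by omega)
      rw [mul_add] at this
      omega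
    have hle' : ∀ y, y ≤ N' → κ0 + p * y ≤ N := fun y hy => by
      have := Nat.mul_le_mul_left p hy
      omega
    have hmem : ∀ y, κ0 + p * y ∈ SS p (n+1) N ↔ y ∈ SS p n N' := by
      intro y
      rw [mem_SS, mem_SS, hlt _ _ _ hκlt]
      constructor
      · rintro ⟨q1, q2, q3⟩
        have := hle y q2
        rw [hsub y this, hlt _ _ _ hιlt] at q3
        exact ⟨q1, this, q3⟩
      · rintro ⟨q1, q2, q3⟩
        rw [hsub y q2, hlt _ _ _ hιlt]
        exact ⟨q1, hle' y q2, q3⟩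
    have hsum : ∑ j ∈ SS p (n+1) N with j % p ^ (k+1) = x % p ^ (k+1), gg p (AF i) (n+1) d N j =
        ∑ y ∈ SS p n N' with y % p ^ k = x' % p ^ k, gg p (AF i) (n+1) d N (κ0 + p * y) := by
      symm
      refine Finset.sum_nbij' (fun y => κ0 + p * y) (fun j => j / p) ?_ ?_ ?_ ?_ ?_
      · intro y hy
        rw [Finset.mem_filter] at hy ⊢
        refine ⟨(hmem y).2 hy.1, ?_⟩
        rw [hxd, hmodk, hmodk, hy.2]
      · intro j hj
        rw [Finset.mem_filter] at hj ⊢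
        have hj0 : j % p = κ0 := by
          have : j % p = x % p := Nat.ModEq.of_dvd (dvd_pow_self p (Nat.succ_ne_zero k)) hj.2
          rw [this, hxd, hmod _ _ hκlt]
        have hjd : κ0 + p * (j / p) = j := by rw [← hj0, Nat.mod_add_div]
        refine ⟨(hmem _).1 (by rw [hjd]; exact hj.1), ?_⟩
        have := hj.2
        rw [hxd, ← hjd, hmodk, hmodk] at this
        exact Nat.eq_of_mul_eq_mul_left hpos (by omega)
      · intro y hy
        exact hdiv _ _ hκlt
      · intro j hj
        rw [Finset.mem_filter] at hj
        have hj0 : j % p = κ0 := by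
          have : j % p = x % p := Nat.ModEq.of_dvd (dvd_pow_self p (Nat.succ_ne_zero k)) hj.2
          rw [this, hxd, hmod _ _ hκlt]
        rw [← hj0, Nat.mod_add_div]
      · intro y hy; rfl
    rw [hsum]
    set r : ℕ → ℤ_[p] := fun y => ρ i (κ0 + p * y) * ρ i (ι0 + p * (N' - y)) with hr
    have hx'S : x' ∈ SS p n N' := (hmem x').1 (by rw [← hxd, mem_SS]; exact hxS)
    have hterm : ∀ y ∈ SS p n N', (p : ℤ_[p]) ^ (n + 1) ∣
        gg p (AF i) (n+1) d N (κ0 + p * y) - r y * gg p (AF (i+1)) n d N' y := by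
      intro y hy
      rw [mem_SS] at hy
      unfold gg
      rw [hsub y hy.2.1]
      have e : ∀ c z, c < p → AF i (d * p ^ (n+1) + (c + p * z)) =
          AF (i+1) (d * p ^ n + z) * ρ i (d * p ^ (n+1) + (c + p * z)) := by
        intro c z hc
        rw [h1 i]
        have : (d * p ^ (n+1) + (c + p * z)) = c + p * (d * p ^ n + z) := by ring
        rw [this, hdiv _ _ hc]
      have e' : ∀ c z, c < p → AF i (c + p * z) = AF (i+1) z * ρ i (c + p * z) := by
        intro c z hc
        rw [h1 i, hdiv _ _ hc]
      have e'' : ∀ w, (p : ℤ_[p]) ^ (n+1) ∣ ρ i (d * p ^ (n+1) + w) - ρ i w := by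
        intro w
        refine h2 i (n+1) _ _ (Nat.succ_ne_zero n) ?_
        simp [Nat.ModEq]
      rw [e _ _ hκlt, e _ _ hιlt, e' _ _ hκlt, e' _ _ hιlt]
      obtain ⟨w1, hw1⟩ := e'' (κ0 + p * y)
      obtain ⟨w2, hw2⟩ := e'' (ι0 + p * (N' - y))
      simp only [hr]
      refine ⟨AF (i+1) (d * p ^ n + y) * AF (i+1) (N' - y) * ρ i (ι0 + p * (N' - y)) * w1
        - AF (i+1) (d * p ^ n + (N' - y)) * AF (i+1) y * ρ i (κ0 + p * y) * w2, ?_⟩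
      linear_combination AF (i+1) (d * p ^ n + y) * AF (i+1) (N' - y) * ρ i (ι0 + p * (N' - y)) * hw1
        - AF (i+1) (d * p ^ n + (N' - y)) * AF (i+1) y * ρ i (κ0 + p * y) * hw2
    have hlip : ∀ j ∈ SS p n N', ∀ j' ∈ SS p n N', ∀ t, j ≡ j' [MOD p ^ t] →
        (p : ℤ_[p]) ^ (t + 1) ∣ r j - r j' := by
      intro j hj j' hj' t hjj
      rw [mem_SS] at hj hj'
      refine dvd_mul_sub_mul _ (h2 i _ _ _ (Nat.succ_ne_zero t) ?_) (h2 i _ _ _ (Nat.succ_ne_zero t) ?_)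
      · refine Nat.ModEq.add_left _ ?_
        rw [pow_succ']
        exact hjj.mul_left' p
      · refine Nat.ModEq.add_left _ ?_
        rw [pow_succ']
        refine Nat.ModEq.mul_left' p ?_
        refine Nat.ModEq.add_right_cancel hjj ?_
        rw [Nat.sub_add_cancel hj.2.1, Nat.sub_add_cancel hj'.2.1]
    have htel := telescope (p : ℤ_[p]) p n 1 (SS p n N') (gg p (AF (i+1)) n d N') r hlip k (by omega)
      (fun k' _ hk' κ => ih (i+1) N' d k' κ hk') x' hx'S
    have hbase := ih (i+1) N' d k (x' % p ^ k) (by omega)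
    have hexp : n + 1 - (k + 1) + 1 = n - k + 1 := by omega
    rw [hexp]
    have hpow : (p : ℤ_[p]) ^ (n - k + 1) ∣ (p : ℤ_[p]) ^ (n + 1) := pow_dvd_pow _ (by omega)
    have e : ∑ y ∈ SS p n N' with y % p ^ k = x' % p ^ k, gg p (AF i) (n+1) d N (κ0 + p * y) =
        ∑ y ∈ SS p n N' with y % p ^ k = x' % p ^ k,
          (gg p (AF i) (n+1) d N (κ0 + p * y) - r y * gg p (AF (i+1)) n d N' y) +
        ∑ y ∈ SS p n N' with y % p ^ k = x' % p ^ k, (r y - r x') * gg p (AF (i+1)) n d N' y +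
        r x' * ∑ y ∈ SS p n N' with y % p ^ k = x' % p ^ k, gg p (AF (i+1)) n d N' y := by
      rw [Finset.mul_sum, ← Finset.sum_add_distrib, ← Finset.sum_add_distrib]
      exact Finset.sum_congr rfl fun j _ => by ring
    rw [e]
    refine dvd_add (dvd_add ?_ (hpow.trans htel)) (hbase.mul_left _)
    refine hpow.trans (Finset.dvd_sum fun y hy => hterm y (Finset.mem_filter.1 hy).1)

end dwork

end HGP


namespace HGP

section windows

variable (p : ℕ) [hp : Fact p.Prime]

/-- the factor `1 - z/b` -/
noncomputable def fz (z b : ℤ_[p]) : ℤ_[p] := 1 - z * iv p b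

theorem fz_congr (z : ℤ_[p]) (n : ℕ) (b b' : ℤ_[p]) (h : (p : ℤ_[p]) ^ n ∣ b - b') :
    (p : ℤ_[p]) ^ n * z ∣ fz p z b - fz p z b' := by
  obtain ⟨w, hw⟩ := iv_congr p n b b' h
  exact ⟨-w, by unfold fz; linear_combination -z * hw⟩

theorem fz_of_dvd (z : ℤ_[p]) {b : ℤ_[p]} (h : (p : ℤ_[p]) ∣ b) : fz p z b = 1 := by
  simp [fz, iv_of_dvd p h]

theorem iv_neg (b : ℤ_[p]) : iv p (-b) = - iv p b := by
  by_cases h : (p : ℤ_[p]) ∣ b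
  · rw [iv_of_dvd p h, iv_of_dvd p ((dvd_neg).2 h)]; simp
  · have h1 := iv_mul p (not_dvd_isUnit p h)
    have h2 := iv_mul p (not_dvd_isUnit p (x := -b) (by rwa [dvd_neg]))
    linear_combination (- iv p b) * h2 - iv p (-b) * h1

/-- the factor `1 - z²/b²` -/
noncomputable def hz (z b : ℤ_[p]) : ℤ_[p] := 1 - z ^ 2 * iv p b ^ 2

theorem fz_mul_neg (z b : ℤ_[p]) : fz p z b * fz p z (-b) = hz p z b := by
  unfold fz hz; rw [iv_neg]; ring

theorem hz_congr (z : ℤ_[p]) (n : ℕ) (b b' : ℤ_[p]) (h : (p : ℤ_[p]) ^ n ∣ b - b') :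
    (p : ℤ_[p]) ^ n * z ^ 2 ∣ hz p z b - hz p z b' := by
  obtain ⟨w, hw⟩ := iv_congr p n b b' h
  exact ⟨-w * (iv p b + iv p b'), by
    unfold hz; linear_combination -z ^ 2 * (iv p b + iv p b') * hw⟩

theorem hz_congr_two (hp2 : p = 2) (z : ℤ_[p]) (n : ℕ) (hn : n ≠ 0) (b b' : ℤ_[p])
    (h : (p : ℤ_[p]) ^ n ∣ b - b') :
    (p : ℤ_[p]) ^ n * z ^ 2 * 2 ∣ hz p z b - hz p z b' := by
  obtain ⟨w, hw⟩ := iv_congr p n b b' h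
  have h2 : (2 : ℤ_[p]) ∣ iv p b + iv p b' := by
    have : (2 : ℤ_[p]) ∣ (p : ℤ_[p]) ^ n * w := by
      have h3 : ((p : ℕ) : ℤ_[p]) = 2 := by
        have := congrArg (Nat.cast : ℕ → ℤ_[p]) hp2
        simpa using this
      rw [h3]
      exact (dvd_pow_self _ hn).mul_right _
    rw [← hw] at this
    have h4 := dvd_add this (dvd_mul_right 2 (iv p b'))
    convert h4 using 1; ring
  obtain ⟨v, hv⟩ := h2
  exact ⟨-w * v, by
    unfold hz; linear_combination -z ^ 2 * (iv p b + iv p b') * hw - z ^ 2 * (p : ℤ_[p]) ^ n * w * hv⟩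

/-- symmetric product -/
noncomputable def TT (z : ℤ_[p]) (n : ℕ) : ℤ_[p] := ∏ j ∈ Finset.range (p ^ n), hz p z j

theorem TT_zero (z : ℤ_[p]) : TT p z 0 = 1 := by
  simp [TT, hz, iv_of_dvd p (dvd_zero _)]

theorem TT_step (z M : ℤ_[p]) (n : ℕ)
    (hM : ∀ b b', (p : ℤ_[p]) ^ n ∣ b - b' → M ∣ hz p z b - hz p z b') :
    M ∣ TT p z (n + 1) - TT p z n ^ p := by
  have key : ∀ D : ℕ, M ∣ ∏ j ∈ Finset.range (p ^ n * D), hz p z j - TT p z n ^ D := by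
    intro D
    induction D with
    | zero => simp
    | succ D ih =>
      rw [mul_add, mul_one, Finset.prod_range_add, pow_succ]
      refine dvd_mul_sub_mul _ ih (dvd_prod_sub_prod _ _ _ _ fun j _ => hM _ _ ?_)
      push_cast
      exact ⟨D, by ring⟩
  have := key p
  rwa [← pow_succ] at this

theorem pow_lift {M x : ℤ_[p]} (h1 : M ∣ x - 1) (h2 : (p : ℤ_[p]) ∣ x - 1) :
    M * p ∣ x ^ p - 1 := by
  have h3 : x ^ p - 1 = (x - 1) * ∑ i ∈ Finset.range p, x ^ i := by
    rw [mul_comm, geom_sum_mul]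
  rw [h3]
  refine mul_dvd_mul h1 ?_
  have h4 : (p : ℤ_[p]) ∣ ∑ i ∈ Finset.range p, (x ^ i - 1) := by
    refine Finset.dvd_sum fun i _ => ?_
    have := dvd_pow_sub_pow' _ h2 i
    simpa using this
  rw [Finset.sum_sub_distrib] at h4
  simp only [Finset.sum_const, Finset.card_range, nsmul_eq_mul, mul_one] at h4
  have := dvd_add h4 (dvd_refl (p : ℤ_[p]))
  simpa using this

theorem p_dvd_TT (z : ℤ_[p]) (hz : (p : ℤ_[p]) ∣ z) (n : ℕ) : (p : ℤ_[p]) ∣ TT p z n - 1 := by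
  have := dvd_prod_sub_prod (p : ℤ_[p]) (Finset.range (p ^ n)) (fun j => HGP.hz p z j) (fun _ => 1)
    (fun j _ => by
      obtain ⟨w, hw⟩ := hz
      exact ⟨- w * z * iv p j ^ 2, by unfold HGP.hz; linear_combination (- z * iv p j ^ 2) * hw⟩)
  simpa [TT] using this

theorem TT_odd (z : ℤ_[p]) (hz : (p : ℤ_[p]) ∣ z) (n : ℕ) : (p : ℤ_[p]) ^ n * z ∣ TT p z n - 1 := by
  induction n with
  | zero => simp [TT_zero]
  | succ n ih =>
    refine dvd_sub_trans' (b := TT p z n ^ p) ?_ ?_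
    · refine Dvd.dvd.trans ?_ (TT_step p z _ n (hz_congr p z n))
      obtain ⟨w, hw⟩ := hz
      exact ⟨w, by linear_combination (p : ℤ_[p]) ^ n * z * hw⟩
    · have := pow_lift p ih (p_dvd_TT p z hz n)
      convert this using 1; ring

theorem prod_neg_congr (z : ℤ_[p]) (n : ℕ) : (p : ℤ_[p]) ^ n * z ∣
    ∏ j ∈ Finset.range (p ^ n), fz p z (-(j : ℤ_[p])) - ∏ j ∈ Finset.range (p ^ n), fz p z j := by
  have h := window p n _ (fz p z) (fz_congr p z n) (-((p ^ n - 1 : ℕ) : ℤ_[p])) 0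
  have e : ∏ j ∈ Finset.range (p ^ n), fz p z (-(j : ℤ_[p])) =
      ∏ j ∈ Finset.range (p ^ n), fz p z (-((p ^ n - 1 : ℕ) : ℤ_[p]) + j) := by
    rw [← Finset.prod_range_reflect]
    refine Finset.prod_congr rfl fun j hj => ?_
    rw [Finset.mem_range] at hj
    rw [Nat.cast_sub (by omega)]
    congr 1; ring
  rw [e]
  simpa using h

theorem window_dvd_z (z b : ℤ_[p]) (m : ℕ) :
    z ∣ ∏ j ∈ Finset.range m, fz p z (b + j) - 1 := by
  have := dvd_prod_sub_prod z (Finset.range m) (fun j => fz p z (b + j)) (fun _ => 1)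
    (fun j _ => ⟨- iv p (b + j), by unfold fz; ring⟩)
  simpa using this

theorem window_odd (hp2 : p ≠ 2) (z : ℤ_[p]) (hz : (p : ℤ_[p]) ∣ z) (n : ℕ) (b : ℤ_[p]) :
    (p : ℤ_[p]) ^ n * z ∣ ∏ j ∈ Finset.range (p ^ n), fz p z (b + j) - 1 := by
  have h := window p n _ (fz p z) (fz_congr p z n) b 0
  refine dvd_sub_trans' h ?_
  set w := ∏ j ∈ Finset.range (p ^ n), fz p z (0 + j) with hw
  have h1 := prod_neg_congr p z n
  have h0 : w = ∏ j ∈ Finset.range (p ^ n), fz p z j := by simp [hw]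
  rw [← h0] at h1
  have h2 : w * ∏ j ∈ Finset.range (p ^ n), fz p z (-(j : ℤ_[p])) = TT p z n := by
    rw [h0, ← Finset.prod_mul_distrib]
    exact Finset.prod_congr rfl fun j _ => fz_mul_neg p z j
  have h3 := TT_odd p z hz n
  have h4 : (p : ℤ_[p]) ^ n * z ∣ (w - 1) * (w + 1) := by
    obtain ⟨x, hx⟩ := h1
    obtain ⟨y, hy⟩ := h3
    exact ⟨y - w * x, by linear_combination hy - w * hx + h2⟩
  have h5 : IsUnit (w + 1) := by
    refine not_dvd_isUnit p fun hd => ?_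
    have h6 := hz.trans (window_dvd_z p z 0 (p ^ n))
    rw [← hw] at h6
    have h7 := dvd_sub hd h6
    have h8 : w + 1 - (w - 1) = ((2 : ℤ) : ℤ_[p]) := by push_cast; ring
    rw [h8, ← PadicInt.norm_lt_one_iff_dvd, PadicInt.norm_intCast_lt_one_iff] at h7
    have h9 : p ∣ 2 := by exact_mod_cast h7
    exact hp2 ((Nat.prime_dvd_prime_iff_eq hp.out Nat.prime_two).1 h9)
  exact (h5.dvd_mul_right).1 h4

end windows

section two

theorem two_unit_of_odd {y : ℤ_[2]} (h : ¬ (2 : ℤ_[2]) ∣ y) : (2 : ℤ_[2]) ∣ y + 1 := by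
  have h1 := PadicInt.appr_spec 1 y
  rw [Ideal.mem_span_singleton] at h1
  have h2 := PadicInt.appr_lt y 1
  simp only [Nat.cast_ofNat, pow_one] at h1 h2
  interval_cases hh : y.appr 1
  · simp at h1; exact absurd h1 h
  · obtain ⟨w, hw⟩ := h1
    exact ⟨w + 1, by push_cast at hw; linear_combination hw⟩

theorem window_two (z : ℤ_[2]) (n : ℕ) (hn : n ≠ 0) (b : ℤ_[2]) :
    (2 : ℤ_[2]) ^ (n + 1) * z ∣ ∏ j ∈ Finset.range (2 ^ (n + 1)), fz 2 z (b + j) - TT 2 z n := by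
  have h := window 2 (n+1) _ (fz 2 z) (fz_congr 2 z (n+1)) b (-(2 : ℤ_[2]) ^ n)
  have e : ∏ j ∈ Finset.range (2 ^ (n + 1)), fz 2 z (-(2 : ℤ_[2]) ^ n + j) = TT 2 z n := by
    have e1 : 2 ^ (n + 1) = 2 ^ n + 2 ^ n := by ring
    rw [e1, Finset.prod_range_add]
    have e2 : ∏ j ∈ Finset.range (2 ^ n), fz 2 z (-(2 : ℤ_[2]) ^ n + j) =
        ∏ j ∈ Finset.range (2 ^ n), fz 2 z (-(j : ℤ_[2])) := by
      have e3 : ∏ j ∈ Finset.range (2 ^ n), fz 2 z (-(2 : ℤ_[2]) ^ n + j) =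
        ∏ j ∈ Finset.range (2 ^ n), fz 2 z (-((j + 1 : ℕ) : ℤ_[2])) := by
        rw [← Finset.prod_range_reflect]
        refine Finset.prod_congr rfl fun j hj => ?_
        rw [Finset.mem_range] at hj
        have : ((2 ^ n - 1 - j : ℕ) : ℤ_[2]) = 2 ^ n - 1 - j := by
          rw [Nat.cast_sub (by omega), Nat.cast_sub (by omega)]; push_cast; ring
        rw [this]
        congr 1; push_cast; ring
      have e4 := Finset.prod_range_succ (fun j : ℕ => fz 2 z (-(j : ℤ_[2]))) (2 ^ n)
      rw [Finset.prod_range_succ', fz_of_dvd 2 z (b := -((0 : ℕ) : ℤ_[2])) (by simp),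
        fz_of_dvd 2 z (b := -((2 ^ n : ℕ) : ℤ_[2])) (by
          rw [dvd_neg]; push_cast; exact dvd_pow_self _ hn), mul_one, mul_one] at e4
      rw [e3, e4]
    rw [e2, TT, ← Finset.prod_mul_distrib]
    refine Finset.prod_congr rfl fun j _ => ?_
    rw [← fz_mul_neg, mul_comm]
    congr 2
    push_cast; ring
  rw [e] at h
  exact_mod_cast h

theorem TT_two_four (z : ℤ_[2]) (hz : (4 : ℤ_[2]) ∣ z) (n : ℕ) :
    (2 : ℤ_[2]) ^ (n + 1) * z ∣ TT 2 z n - 1 := by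
  have h2z : ((2 : ℕ) : ℤ_[2]) ∣ z := by
    obtain ⟨w, rfl⟩ := hz
    exact ⟨2 * w, by push_cast; ring⟩
  induction n with
  | zero => simp [TT_zero]
  | succ n ih =>
    refine dvd_sub_trans' (b := TT 2 z n ^ 2) ?_ ?_
    · refine Dvd.dvd.trans ?_ (TT_step 2 z _ n (hz_congr 2 z n))
      obtain ⟨w, hw⟩ := hz
      exact ⟨w, by push_cast; linear_combination (2 : ℤ_[2]) ^ n * z * hw⟩
    · have := pow_lift 2 ih (p_dvd_TT 2 z h2z n)
      convert this using 1; push_cast; ring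

theorem TT_two_two (y : ℤ_[2]) (hy : ¬ (2 : ℤ_[2]) ∣ y) (n : ℕ) :
    (2 : ℤ_[2]) ^ (n + 3) ∣ TT 2 (2 * y) (n + 1) - (1 + 2 ^ (n + 2)) := by
  induction n with
  | zero =>
    obtain ⟨w, hw⟩ := two_unit_of_odd hy
    have h1 : iv 2 (1 : ℤ_[2]) = 1 := by simp [iv]
    have : TT 2 (2 * y) (0 + 1) = 1 - 4 * y ^ 2 := by
      simp only [TT, zero_add, pow_one, Finset.prod_range_succ, Finset.prod_range_zero]
      simp only [hz, Nat.cast_zero, Nat.cast_one, h1, iv_of_dvd 2 (dvd_zero _)]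
      ring
    rw [this]
    refine ⟨- (2 * w ^ 2 - 2 * w + 1), ?_⟩
    have : y = 2 * w - 1 := by linear_combination hw
    rw [this]; ring
  | succ n ih =>
    refine dvd_sub_trans' (b := TT 2 (2 * y) (n+1) ^ 2) ?_ ?_
    · refine Dvd.dvd.trans ?_ (TT_step 2 (2 * y) _ (n+1) (hz_congr_two 2 rfl (2 * y) (n+1) (by omega)))
      exact ⟨y ^ 2, by push_cast; ring⟩
    · obtain ⟨w, hw⟩ := ih
      have : TT 2 (2 * y) (n+1) = 1 + 2 ^ (n+2) * (1 + 2 * w) := by linear_combination hw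
      rw [this]
      exact ⟨w + 2 ^ n * (1 + 2 * w) ^ 2, by ring⟩

end two

section Psi

variable (p : ℕ) [hp : Fact p.Prime]

/-- `Ψ_k(X) = ∏_{i ≤ k, p ∤ i} (1 - X/i)` -/
noncomputable def Psi (k : ℕ) : Polynomial ℤ_[p] :=
  ∏ j ∈ Finset.range k, (1 - Polynomial.C (iv p ((j : ℤ_[p]) + 1)) * Polynomial.X)

/-- `(Ψ_k - 1)/X` -/
noncomputable def RR (k : ℕ) : Polynomial ℤ_[p] := (Psi p k).divX

theorem Psi_eval (k : ℕ) (z : ℤ_[p]) :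
    (Psi p k).eval z = ∏ j ∈ Finset.range k, fz p z ((j : ℤ_[p]) + 1) := by
  simp only [Psi, Polynomial.eval_prod]
  refine Finset.prod_congr rfl fun j _ => ?_
  simp [fz]; ring

theorem Psi_eval_RR (k : ℕ) (z : ℤ_[p]) : (Psi p k).eval z = 1 + z * (RR p k).eval z := by
  have h := Polynomial.divX_mul_X_add (Psi p k)
  have h0 : (Psi p k).coeff 0 = 1 := by
    rw [Polynomial.coeff_zero_eq_eval_zero, Psi_eval]
    simp [fz]
  rw [h0] at h
  conv_lhs => rw [← h]
  simp [RR]; ring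

theorem Psi_eval_add (k m : ℕ) (z : ℤ_[p]) : (Psi p (k + m)).eval z =
    (Psi p k).eval z * ∏ j ∈ Finset.range m, fz p z (((k : ℤ_[p]) + 1) + j) := by
  rw [Psi_eval, Psi_eval, Finset.prod_range_add]
  congr 1
  refine Finset.prod_congr rfl fun j _ => ?_
  congr 1; push_cast; ring

theorem RR_step (k m : ℕ) (z : ℤ_[p]) : z * ((RR p (k + m)).eval z - (RR p k).eval z) =
    (Psi p k).eval z * (∏ j ∈ Finset.range m, fz p z (((k : ℤ_[p]) + 1) + j) - 1) := by
  have h1 := Psi_eval_add p k m z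
  have h2 := Psi_eval_RR p (k + m) z
  have h3 := Psi_eval_RR p k z
  linear_combination h1 - h2 + h3

theorem RR_shift (k : ℕ) (z h : ℤ_[p]) : h ∣ (RR p k).eval (z + h) - (RR p k).eval z := by
  have := Polynomial.sub_dvd_eval_sub (z + h) z (RR p k)
  simpa using this

end Psi

/-- good functions on `{k : k % p = l}` -/
def Good {R : Type*} [CommRing R] (p l : ℕ) (z g : ℕ → R) : Prop :=
  ∃ Q : ℕ → R, (∀ k, k % p = l → g k = 1 + z k * Q k) ∧
    ∀ n k k', k % p = l → k' % p = l → k ≡ k' [MOD p ^ n] → (p : R) ^ n ∣ Q k - Q k'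

theorem Good.of_step {R : Type*} [CommRing R] {p l : ℕ} {z g : ℕ → R} (Q : ℕ → R)
    (h1 : ∀ k, k % p = l → g k = 1 + z k * Q k)
    (h2 : ∀ n k, k % p = l → (p : R) ^ (n+1) ∣ Q (k + p ^ (n+1)) - Q k) : Good p l z g := by
  refine ⟨Q, h1, fun n k k' hk hk' hkk => ?_⟩
  rcases n with _ | n
  · simp
  refine lip_of_step _ (p ^ (n+1)) (fun k => k % p = l) (fun k hk => ?_) Q (fun k hk => h2 n k hk) k k' hk hk' hkk
  rw [← hk, pow_succ', Nat.add_mul_mod_self_left]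

theorem good_psi_odd (p : ℕ) [hp : Fact p.Prime] (hp2 : p ≠ 2) {a a' : ℤ_[p]} {l : ℕ}
    (ha : NotNonposInt p a)
    (hl : l < p) (h : (p : ℤ_[p]) * a' = a + l) :
    Good p l (fun k => a + k) (fun k => (Psi p k).eval (a + k)) := by
  refine Good.of_step (fun k => (RR p k).eval (a + k)) (fun k _ => Psi_eval_RR p k _) ?_
  intro n k hk
  have hz : (p : ℤ_[p]) ∣ a + k := (dvd_add_iff p hl h k).2 hk
  have h1 := RR_shift p (k + p ^ (n+1)) (a + k) ((p : ℤ_[p]) ^ (n+1))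
  have e : a + ((k + p ^ (n+1) : ℕ) : ℤ_[p]) = a + k + (p : ℤ_[p]) ^ (n+1) := by push_cast; ring
  rw [e]
  refine dvd_sub_trans' h1 ?_
  have h2 := RR_step p k (p ^ (n+1)) (a + k)
  obtain ⟨w, hw⟩ := window_odd p hp2 (a + k) hz (n+1) ((k : ℤ_[p]) + 1)
  rw [hw] at h2
  refine ⟨(Psi p k).eval (a + k) * w, mul_left_cancel₀ (ha k) ?_⟩
  linear_combination h2

theorem good_psi_two {a a' : ℤ_[2]} {l : ℕ} (ha : NotNonposInt 2 a)
    (hl : l < 2) (h : (2 : ℤ_[2]) * a' = a + l) :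
    Good 2 l (fun k => a + k)
      (fun k => (if (4 : ℤ_[2]) ∣ a + k then 1 else -1) * (Psi 2 k).eval (a + k)) := by
  have hdv : ∀ k : ℕ, k % 2 = l → (2 : ℤ_[2]) ∣ a + k := fun k hk => by
    have := (dvd_add_iff 2 hl (by exact_mod_cast h) k).2 hk
    exact_mod_cast this
  have hy : ∀ k : ℕ, ∃ y : ℤ_[2], k % 2 = l → a + k = 2 * y := fun k => by
    by_cases hk : k % 2 = l
    · obtain ⟨y, hy⟩ := hdv k hk
      exact ⟨y, fun _ => hy⟩
    · exact ⟨0, fun h => absurd h hk⟩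
  choose y hy using hy
  have two_ne : (2 : ℤ_[2]) ≠ 0 := two_ne_zero
  have h4 : ∀ k, k % 2 = l → ((4 : ℤ_[2]) ∣ a + k ↔ (2 : ℤ_[2]) ∣ y k) := fun k hk => by
    rw [hy k hk, show (4 : ℤ_[2]) = 2 * 2 by norm_num]
    exact mul_dvd_mul_iff_left two_ne
  have hiv : ∀ k, ¬ (2 : ℤ_[2]) ∣ y k → y k * iv 2 (y k) = 1 := fun k hk =>
    iv_mul 2 (not_dvd_isUnit 2 (by exact_mod_cast hk))
  have odd_mul : ∀ {x w : ℤ_[2]}, ¬ (2 : ℤ_[2]) ∣ x → ¬ (2 : ℤ_[2]) ∣ w → ¬ (2 : ℤ_[2]) ∣ x * w := by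
    intro x w hx hw hxw
    have : Prime (2 : ℤ_[2]) := by exact_mod_cast PadicInt.prime_p (p := 2)
    rcases this.dvd_or_dvd hxw with h | h <;> contradiction
  have odd_iv : ∀ k, ¬ (2 : ℤ_[2]) ∣ y k → ¬ (2 : ℤ_[2]) ∣ iv 2 (y k) := by
    intro k hk hd
    have h1 := hd.mul_left (y k)
    rw [hiv k hk] at h1
    exact (isUnit_iff_not_dvd 2).1 isUnit_one (by exact_mod_cast h1)
  have odd_one : ¬ (2 : ℤ_[2]) ∣ 1 := fun h1 =>
    (isUnit_iff_not_dvd 2).1 isUnit_one (by exact_mod_cast h1)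
  have oddPsi : ∀ k, k % 2 = l → ¬ (2 : ℤ_[2]) ∣ (Psi 2 k).eval (a + k) := by
    intro k hk hd
    rw [Psi_eval_RR] at hd
    have := dvd_sub hd ((hdv k hk).mul_right ((RR 2 k).eval (a + k)))
    simp only [add_sub_cancel_right] at this
    exact odd_one this
  refine Good.of_step (fun k => if (4 : ℤ_[2]) ∣ a + k then (RR 2 k).eval (a + k)
    else - (RR 2 k).eval (a + k) - iv 2 (y k)) ?_ ?_
  · intro k hk
    by_cases hc : (4 : ℤ_[2]) ∣ a + k
    · rw [if_pos hc, if_pos hc, one_mul, Psi_eval_RR]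
    · rw [if_neg hc, if_neg hc, Psi_eval_RR]
      have h1 := hiv k (mt (h4 k hk).2 hc)
      have h2 := hy k hk
      linear_combination iv 2 (y k) * h2 + 2 * h1
  · intro n k hk
    have hk' : (k + 2 ^ (n+1)) % 2 = l := by rw [← hk, pow_succ', Nat.add_mul_mod_self_left]
    have e : a + ((k + 2 ^ (n+1) : ℕ) : ℤ_[2]) = a + k + (2 : ℤ_[2]) ^ (n+1) := by push_cast; ring
    have hy' : y (k + 2 ^ (n+1)) = y k + 2 ^ n := by
      have h1 := hy k hk
      have h2 := hy _ hk'
      rw [e, h1] at h2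
      refine mul_left_cancel₀ two_ne ?_
      rw [← h2]; ring
    have h1 := RR_shift 2 (k + 2 ^ (n+1)) (a + k) ((2 : ℤ_[2]) ^ (n+1))
    have h2 := RR_step 2 k (2 ^ (n+1)) (a + k)
    simp only [h4 k hk, h4 _ hk']
    have hodd := oddPsi k hk
    set ps := (Psi 2 k).eval (a + k) with hps
    rw [e, hy'] 
    push_cast
    set r := (RR 2 k).eval (a + k) with hr
    set r' := (RR 2 (k + 2 ^ (n+1))).eval (a + k) with hr'
    set r'' := (RR 2 (k + 2 ^ (n+1))).eval (a + k + 2 ^ (n+1)) with hr''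
    clear_value r r' r'' ps
    have odd_iv2 : ∀ x : ℤ_[2], ¬ (2 : ℤ_[2]) ∣ x → ¬ (2 : ℤ_[2]) ∣ iv 2 x := by
      intro x hx hd
      have h1 := hd.mul_left x
      rw [iv_mul 2 (not_dvd_isUnit 2 (by exact_mod_cast hx))] at h1
      exact odd_one h1
    have odd_add : ∀ x w : ℤ_[2], ¬ (2 : ℤ_[2]) ∣ x → ¬ (2 : ℤ_[2]) ∣ w → (2 : ℤ_[2]) ∣ x + w := by
      intro x w hx hw
      obtain ⟨x', hx'⟩ := two_unit_of_odd hx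
      obtain ⟨w', hw'⟩ := two_unit_of_odd hw
      exact ⟨x' + w' - 1, by linear_combination hx' + hw'⟩
    have flip : ∀ x : ℤ_[2], (2 : ℤ_[2]) ∣ x → ¬ (2 : ℤ_[2]) ∣ x + 1 := by
      intro x hx hx1
      have := dvd_sub hx1 hx
      simp only [add_sub_cancel_left] at this
      exact odd_one this
    rcases n with _ | n
    · simp only [zero_add, pow_one, pow_zero] at h1 h2 ⊢
      have h3 : ¬ (2 : ℤ_[2]) ∣ r' - r := by
        simp only [Finset.prod_range_succ, Finset.prod_range_zero, one_mul, Nat.cast_zero,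
          Nat.cast_one, add_zero] at h2
        by_cases hk1 : (2 : ℤ_[2]) ∣ (k : ℤ_[2]) + 1
        · rw [fz_of_dvd 2 _ (b := (k : ℤ_[2]) + 1) (by exact_mod_cast hk1)] at h2
          have h5 : r' - r = - (ps * iv 2 ((k : ℤ_[2]) + 1 + 1)) := by
            refine mul_left_cancel₀ (ha k) ?_
            rw [h2]; unfold fz; ring
          rw [h5, dvd_neg]
          exact odd_mul hodd (odd_iv2 _ (flip _ hk1))
        · rw [fz_of_dvd 2 _ (b := (k : ℤ_[2]) + 1 + 1) (by exact_mod_cast two_unit_of_odd hk1)] at h2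
          have h5 : r' - r = - (ps * iv 2 ((k : ℤ_[2]) + 1)) := by
            refine mul_left_cancel₀ (ha k) ?_
            rw [h2]; unfold fz; ring
          rw [h5, dvd_neg]
          exact odd_mul hodd (odd_iv2 _ hk1)
      obtain ⟨α, hα⟩ := h1
      by_cases hyk : (2 : ℤ_[2]) ∣ y k
      · rw [if_neg (flip _ hyk), if_pos hyk]
        obtain ⟨β, hβ⟩ := odd_add _ _ h3 (odd_iv2 _ (flip _ hyk))
        exact ⟨-r - α - β, by linear_combination -hα - hβ⟩
      · rw [if_pos (two_unit_of_odd hyk), if_neg hyk]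
        obtain ⟨β, hβ⟩ := odd_add _ _ h3 (odd_iv2 _ hyk)
        exact ⟨r + α + β, by linear_combination hα + hβ⟩
    · have hpar : (2 : ℤ_[2]) ∣ y k + 2 ^ (n+1) ↔ (2 : ℤ_[2]) ∣ y k :=
        dvd_add_left (dvd_pow_self _ (by omega))
      have hw := window_two (a + k) (n+1) (by omega) ((k : ℤ_[2]) + 1)
      obtain ⟨α, hα⟩ := h1
      simp only [hpar]
      push_cast at hw hα
      by_cases hyk : (2 : ℤ_[2]) ∣ y k
      · rw [if_pos hyk, if_pos hyk]
        have h6 := dvd_sub_trans' hw (TT_two_four (a + k) ((h4 k hk).2 hyk) (n+1))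
        obtain ⟨w, hw⟩ := h6
        rw [hw] at h2
        refine ⟨α + ps * w, mul_left_cancel₀ (ha k) ?_⟩
        linear_combination h2 + (a + k) * hα
      · rw [if_neg hyk, if_neg hyk]
        obtain ⟨w, hw⟩ := hw
        obtain ⟨w', hw'⟩ := TT_two_two (y k) hyk n
        rw [hy k hk] at hw h2
        have i1 := hiv k hyk
        have i2 := iv_mul 2 (x := y k + 2 ^ (n+1)) (not_dvd_isUnit 2 (by
          have := mt hpar.1 hyk
          exact_mod_cast this))
        have o1 := odd_iv2 _ hyk
        have o2 := odd_iv2 _ (mt hpar.1 hyk)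
        set i := iv 2 (y k)
        set i' := iv 2 (y k + 2 ^ (n+1))
        obtain ⟨β, hβ⟩ := odd_add _ _ (odd_mul hodd o1) (odd_mul o1 o2)
        have h7 : y k * (r' - r) = 2 ^ (n+1) * ps * (1 + 2 * (w' + y k * w)) := by
          refine mul_left_cancel₀ two_ne ?_
          linear_combination h2 + ps * hw + ps * hw'
        have h8 : r' - r = 2 ^ (n+1) * ps * (1 + 2 * (w' + y k * w)) * i := by
          linear_combination i * h7 - (r' - r) * i1
        have h9 : i' - i = - 2 ^ (n+1) * i * i' := by
          linear_combination i * i2 - i' * i1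
        exact ⟨-α - ps * (w' + y k * w) * i - β + i * i', by
          linear_combination -hα - h8 - h9 - 2 ^ (n+1) * hβ⟩

end HGP


namespace HGP

section cpw

variable (p : ℕ) [hp : Fact p.Prime]

theorem fact_dvd_qpow (i : ℕ) (hi : 2 ≤ i) :
    (p : ℤ_[p]) ^ 2 * (i.factorial : ℤ_[p]) ∣ ((qq p : ℕ) : ℤ_[p]) ^ i := by
  have hne := fact_ne p i
  have h1 := PadicInt.unitCoeff_spec hne
  have hv : (i.factorial : ℤ_[p]).valuation = padicValNat p i.factorial := by
    have h0 := PadicInt.valuation_coe (i.factorial : ℤ_[p])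
    rw [PadicInt.coe_natCast, Padic.valuation_natCast] at h0
    exact_mod_cast h0.symm
  have hlt := sub_one_mul_padicValNat_factorial_lt_of_ne_zero p (n := i) (by omega)
  rw [hv] at h1
  set v := padicValNat p i.factorial
  rw [h1, mul_left_comm, ← pow_add, (Units.isUnit _).mul_left_dvd]
  by_cases hp2 : p = 2
  · have e : ((qq p : ℕ) : ℤ_[p]) = (p : ℤ_[p]) ^ 2 := by
      have : qq p = p ^ 2 := by simp [qq, hp2]
      rw [this]; push_cast; ring
    rw [e, ← pow_mul]
    have : v < i := by
      have h3 : p - 1 = 1 := by omega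
      rw [h3] at hlt; omega
    exact pow_dvd_pow _ (by omega)
  · have e : ((qq p : ℕ) : ℤ_[p]) = (p : ℤ_[p]) := by
      have : qq p = p := by simp [qq, hp2]
      rw [this]
    rw [e]
    have h3 : 2 ≤ p - 1 := by have := hp.out.two_le; omega
    have h4 : 2 * v ≤ (p - 1) * v := Nat.mul_le_mul_right _ h3
    exact pow_dvd_pow _ (by omega)

theorem exists_e (u : Wp p) : ∃ e : ℕ → Wp p,
    (∀ i, 1 ≤ i → (p : Wp p) * (i.factorial : Wp p) * e i = ((qq p : Wp p) * u) ^ i) ∧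
    ∀ i, 2 ≤ i → (p : Wp p) ∣ e i := by
  have : ∀ i : ℕ, ∃ w : Wp p,
      (1 ≤ i → (p : Wp p) * (i.factorial : Wp p) * w = ((qq p : Wp p) * u) ^ i) ∧
      (2 ≤ i → (p : Wp p) ∣ w) := by
    intro i
    rcases lt_or_ge i 2 with h | h
    · interval_cases i
      · exact ⟨0, by omega, by omega⟩
      · have : p ∣ qq p := by
          unfold qq; split_ifs with h2
          · rw [h2]; norm_num
          · exact dvd_rfl
        obtain ⟨w, hw⟩ := this
        refine ⟨(w : Wp p) * u, fun _ => ?_, by omega⟩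
        rw [hw]; push_cast; simp; ring
    · obtain ⟨w, hw⟩ := fact_dvd_qpow p i h
      have hw' := congrArg (iota p) hw
      simp only [map_pow, map_mul, map_natCast] at hw'
      refine ⟨p * iota p w * u ^ i, fun _ => ?_, fun _ => ⟨iota p w * u ^ i, by ring⟩⟩
      rw [mul_pow, hw']; ring
  choose e he using this
  exact ⟨e, fun i => (he i).1, fun i => (he i).2⟩

theorem exists_E (u c : Wp p) (hc : c = 1 + (qq p : Wp p) * u) (M : ℕ) : ∃ E : Wp p → Wp p,
    (∀ y : ℕ, y ≤ M → c ^ y = 1 + p * y * E y) ∧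
    ∀ y y', (p : Wp p) * (y - y') ∣ E y - E y' := by
  obtain ⟨e, he1, he2⟩ := exists_e p u
  refine ⟨fun y => ∑ i ∈ Finset.range M, e (i+1) * (descPochhammer (Wp p) i).eval (y - 1), ?_, ?_⟩
  · intro y hy
    have h1 : c ^ y = ∑ i ∈ Finset.range (M + 1), ((qq p : Wp p) * u) ^ i * (y.choose i : Wp p) := by
      rw [hc, add_comm 1, add_pow]
      simp only [one_pow, mul_one]
      refine Finset.sum_subset (by intro x; simp only [Finset.mem_range]; omega) ?_
      intro x _ hx
      rw [Finset.mem_range, not_lt] at hx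
      rw [Nat.choose_eq_zero_of_lt (by omega)]; simp
    rw [h1, Finset.sum_range_succ', Finset.mul_sum]
    simp only [pow_zero, Nat.choose_zero_right, Nat.cast_one, one_mul]
    rw [add_comm]
    congr 1
    refine Finset.sum_congr rfl fun i _ => ?_
    rw [← he1 (i+1) (by omega)]
    rcases y with _ | y
    · simp
    · have h2 : ((y + 1 : ℕ) : Wp p) - 1 = (y : ℕ) := by push_cast; ring
      rw [h2, descPochhammer_eval_eq_descFactorial]
      have h3 : (i+1).factorial * (y+1).choose (i+1) = (y + 1) * y.descFactorial i := by
        rw [← Nat.descFactorial_eq_factorial_mul_choose, Nat.succ_descFactorial_succ]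
      have h4 : ((i+1).factorial : Wp p) * ((y+1).choose (i+1) : Wp p) =
          ((y + 1 : ℕ) : Wp p) * (y.descFactorial i : Wp p) := by exact_mod_cast congrArg (Nat.cast : ℕ → Wp p) h3
      linear_combination (p : Wp p) * e (i+1) * h4
  · intro y y'
    rw [← Finset.sum_sub_distrib]
    refine Finset.dvd_sum fun i _ => ?_
    rw [← mul_sub]
    rcases i with _ | i
    · simp
    · refine mul_dvd_mul (he2 _ (by omega)) ?_
      have := Polynomial.sub_dvd_eval_sub (y - 1) (y' - 1) (descPochhammer (Wp p) (i+1))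
      simpa using this

theorem iota_inj : Function.Injective (iota p) := by
  unfold iota
  refine (WittVector.map_injective _ (algebraMap (ZMod p) (Fbar p)).injective).comp ?_
  exact (WittVector.equiv p).symm.injective

theorem iota_pow_dvd {n : ℕ} {x : ℤ_[p]} (h : (p : ℤ_[p]) ^ n ∣ x) : (p : Wp p) ^ n ∣ iota p x := by
  have := map_dvd (iota p) h
  simpa using this

theorem appr_iota (x : ℤ_[p]) (N : ℕ) : ∃ w : Wp p, iota p x = (x.appr N : Wp p) + (p : Wp p) ^ N * w := by
  have := PadicInt.appr_spec N x
  rw [Ideal.mem_span_singleton] at this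
  obtain ⟨w, hw⟩ := this
  have hw' := congrArg (iota p) hw
  simp only [map_sub, map_mul, map_pow, map_natCast] at hw'
  exact ⟨iota p w, by linear_combination hw'⟩

theorem exists_Qc (u c : Wp p) (hc : c = 1 + (qq p : Wp p) * u)
    (cpw : ℤ_[p] → Wp p) (hcpw : IsCpow p c cpw) : ∃ Q : ℤ_[p] → Wp p,
    (∀ x, x ≠ 0 → cpw x = 1 + p * iota p x * Q x) ∧
    ∀ n x x', x ≠ 0 → x' ≠ 0 → (p : ℤ_[p]) ^ n ∣ x - x' → (p : Wp p) ^ (n+1) ∣ Q x - Q x' := by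
  have pne : (p : Wp p) ≠ 0 := WittVector.p_nonzero _ _
  -- divisibility of p-powers
  have hdiv : ∀ x : ℤ_[p], x ≠ 0 → ∃ w : Wp p, iota p x * w = (p : Wp p) ^ x.valuation := by
    intro x hx
    have h1 := PadicInt.unitCoeff_spec hx
    have h2 : x * ((PadicInt.unitCoeff hx)⁻¹ : ℤ_[p]ˣ) = (p : ℤ_[p]) ^ x.valuation := by
      rw [Units.mul_inv_eq_iff_eq_mul, mul_comm]
      exact h1
    have h3 := congrArg (iota p) h2
    simp only [map_mul, map_pow, map_natCast] at h3
    exact ⟨_, h3⟩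
  -- main approximation
  have key : ∀ x : ℤ_[p], x ≠ 0 → ∀ t M : ℕ, p ^ (x.valuation + 1 + t) ≤ M → ∀ E : Wp p → Wp p,
      (∀ y : ℕ, y ≤ M → c ^ y = 1 + p * y * E y) →
      ∃ w, cpw x = 1 + p * iota p x * (E (x.appr (x.valuation + 1 + t)) + p ^ t * w) := by
    intro x hx t M hM E hE
    have hlt := PadicInt.appr_lt x (x.valuation + 1 + t)
    have h1 := hcpw x (x.valuation + 1 + t)
    rw [Ideal.mem_span_singleton, hE _ (by omega)] at h1
    obtain ⟨w1, hw1⟩ := h1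
    obtain ⟨w2, hw2⟩ := appr_iota p x (x.valuation + 1 + t)
    obtain ⟨w3, hw3⟩ := hdiv x hx
    set y : Wp p := (x.appr (x.valuation + 1 + t) : Wp p)
    refine ⟨w3 * w1 - p * w3 * w2 * E y, ?_⟩
    rw [pow_add, pow_add, ← hw3] at hw1 hw2
    linear_combination hw1 - p * E y * hw2
  have ex : ∀ x : ℤ_[p], ∃ Q : Wp p, x ≠ 0 → cpw x = 1 + p * iota p x * Q := by
    intro x
    by_cases hx : x = 0
    · exact ⟨0, fun h => absurd hx h⟩
    · obtain ⟨E, hE1, -⟩ := exists_E p u c hc (p ^ (x.valuation + 1 + 0))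
      obtain ⟨w, hw⟩ := key x hx 0 _ le_rfl E hE1
      exact ⟨_, fun _ => hw⟩
  choose Q hQ using ex
  refine ⟨Q, hQ, ?_⟩
  intro n x x' hx hx' hxx
  have hpos := hp.out.one_lt
  obtain ⟨E, hE1, hE2⟩ := exists_E p u c hc
    (p ^ (x.valuation + 1 + (n + 1)) + p ^ (x'.valuation + 1 + (n + 1)))
  have kk : ∀ y : ℤ_[p], y ≠ 0 → p ^ (y.valuation + 1 + (n+1)) ≤
      (p ^ (x.valuation + 1 + (n + 1)) + p ^ (x'.valuation + 1 + (n + 1))) →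
      ∃ w, Q y - E (iota p y) = p ^ (n + 1) * w := by
    intro y hy hM
    obtain ⟨w, hw⟩ := key y hy (n+1) _ hM E hE1
    rw [hQ y hy] at hw
    have hiy : (p : Wp p) * iota p y ≠ 0 := mul_ne_zero pne (fun h => hy (iota_inj p (by simpa using h)))
    have h5 : Q y = E (y.appr (y.valuation + 1 + (n+1))) + p ^ (n+1) * w :=
      mul_left_cancel₀ hiy (by linear_combination hw)
    obtain ⟨w2, hw2⟩ := appr_iota p y (y.valuation + 1 + (n+1))
    obtain ⟨w4, hw4⟩ := hE2 (y.appr (y.valuation + 1 + (n+1))) (iota p y)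
    refine ⟨w - p * p ^ (y.valuation + 1) * w2 * w4, ?_⟩
    rw [pow_add (p : Wp p) (y.valuation + 1)] at hw2
    linear_combination h5 + hw4 - p * w4 * hw2
  obtain ⟨w1, h1⟩ := kk x hx (by omega)
  obtain ⟨w2, h2⟩ := kk x' hx' (by omega)
  obtain ⟨w3, h3⟩ := hE2 (iota p x) (iota p x')
  obtain ⟨w4, h4⟩ := iota_pow_dvd p hxx
  rw [map_sub] at h4
  refine ⟨w1 - w2 + w4 * w3, ?_⟩
  linear_combination h1 - h2 + h3 + p * w3 * h4

end cpw

section sign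

variable (p : ℕ) [hp : Fact p.Prime]

theorem curly_reflect {a : ℤ_[p]} {k : ℕ} (hz : (p : ℤ_[p]) ∣ a + k) :
    curly p a k = curly p 1 k * (-1) ^ (k + k / p) * (Psi p k).eval (a + k) := by
  have hs : ∀ m : ℕ, ((-1 : ℤ_[p])) ^ (m + m / p) =
      ∏ j ∈ Finset.range m, if p ∣ j + 1 then (1 : ℤ_[p]) else -1 := by
    intro m
    induction m with
    | zero => simp
    | succ m ih =>
      rw [Finset.prod_range_succ, ← ih, Nat.succ_div]
      split_ifs
      · rw [show m + 1 + (m / p + 1) = m + m / p + 2 by ring, pow_add]; norm_num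
      · rw [show m + 1 + (m / p + 0) = m + m / p + 1 by ring, pow_add]; norm_num
  rw [hs, Psi_eval, curly_eq, curly_eq, ← Finset.prod_mul_distrib, ← Finset.prod_mul_distrib,
    ← Finset.prod_range_reflect]
  refine Finset.prod_congr rfl fun j hj => ?_
  rw [Finset.mem_range] at hj
  have e : a + ((k - 1 - j : ℕ) : ℤ_[p]) = (a + k) - (j + 1) := by
    rw [Nat.cast_sub (by omega), Nat.cast_sub (by omega)]; push_cast; ring
  have hpj : p ∣ j + 1 ↔ (p : ℤ_[p]) ∣ (j : ℤ_[p]) + 1 := by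
    have h1 := PadicInt.norm_natCast_lt_one_iff (p := p) (n := j + 1)
    rw [PadicInt.norm_lt_one_iff_dvd] at h1
    rw [← h1]; push_cast; rfl
  have hpj2 : (p : ℤ_[p]) ∣ (a + k) - (j + 1) ↔ (p : ℤ_[p]) ∣ (j : ℤ_[p]) + 1 :=
    (dvd_sub_right hz)
  rw [e]
  by_cases h : p ∣ j + 1
  · have h' := hpj.1 h
    rw [if_pos h, fz_of_dvd p _ h', f0, if_pos (hpj2.2 h'), f0, if_pos (by rwa [add_comm])]; ring
  · have h' := mt hpj.2 h
    rw [if_neg h, f0, if_neg (mt hpj2.1 h'), f0, if_neg (by rwa [add_comm]), fz]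
    have := iv_mul p (not_dvd_isUnit p h')
    linear_combination -(a + k) * this

theorem dl_lt (a : ℤ_[p]) : dl p a < p := by
  have := PadicInt.appr_lt (-a) 1
  simpa [dl] using this

theorem sign_odd (hp2 : p ≠ 2) (a : ℤ_[p]) (k : ℕ) (hk : k % p = dl p a) :
    ((-1 : ℤ_[p])) ^ de p a * (-1) ^ (k + k / p) = 1 := by
  have h1 : dl' p a = dl p a := by simp [dl', dl, hp2]
  have h2 : de p a = k % p := by
    rw [de, h1, Nat.div_eq_of_lt (dl_lt p a), hk]; rfl
  rw [h2, ← pow_add]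
  refine Even.neg_one_pow ?_
  have h3 := Nat.mod_add_div k p
  have h4 : Odd p := hp.out.odd_of_ne_two hp2
  obtain ⟨m, hm⟩ := h4
  refine ⟨k % p + (m + 1) * (k / p), ?_⟩
  have h5 : p * (k / p) = 2 * m * (k / p) + k / p := by
    conv_lhs => rw [hm, ← hm]
    nth_rw 1 [hm]; ring
  nlinarith

theorem sign_two (a : ℤ_[2]) (k : ℕ) (hk : k % 2 = dl 2 a) :
    ((-1 : ℤ_[2])) ^ de 2 a * (-1) ^ (k + k / 2) = if (4 : ℤ_[2]) ∣ a + k then 1 else -1 := by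
  have hL := PadicInt.appr_lt (-a) 2
  have hLs := PadicInt.appr_spec 2 (-a)
  rw [Ideal.mem_span_singleton] at hLs
  have hl := PadicInt.appr_lt (-a) 1
  have hls := PadicInt.appr_spec 1 (-a)
  rw [Ideal.mem_span_singleton] at hls
  have hd : dl' 2 a = (-a).appr 2 := by simp [dl']
  rw [de, hd]
  rw [dl] at hk
  set L := (-a).appr 2
  set l := (-a).appr 1
  have h4 : (4 : ℤ_[2]) ∣ a + k ↔ k % 4 = L % 4 := by
    have h1 : (4 : ℤ_[2]) ∣ a + k ↔ (4 : ℤ_[2]) ∣ (((k : ℤ) - L : ℤ) : ℤ_[2]) := by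
      obtain ⟨w, hw⟩ := hLs
      have : a + k = 4 * (-w) + (((k : ℤ) - L : ℤ) : ℤ_[2]) := by
        push_cast at hw ⊢; linear_combination -hw
      rw [this]
      exact dvd_add_right (dvd_mul_right _ _)
    have h2 := PadicInt.norm_int_le_pow_iff_dvd (p := 2) (k := (k : ℤ) - L) (n := 2)
    rw [PadicInt.norm_le_pow_iff_mem_span_pow, Ideal.mem_span_singleton] at h2
    have h3 : (((2 : ℕ) : ℤ_[2])) ^ 2 = 4 := by push_cast; norm_num
    rw [h3] at h2
    rw [h1, h2]
    push_cast
    omega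
  have h2 : L % 2 = l % 2 := by
    have h5 : ((2 : ℕ) : ℤ_[2]) ∣ (((l : ℤ) - L : ℤ) : ℤ_[2]) := by
      have h6 := (pow_dvd_pow ((2 : ℕ) : ℤ_[2]) (show 1 ≤ 2 by norm_num)).trans hLs
      have h7 := dvd_sub h6 hls
      rw [pow_one] at h7
      convert h7 using 1; push_cast; ring
    rw [← PadicInt.norm_lt_one_iff_dvd, PadicInt.norm_intCast_lt_one_iff] at h5
    push_cast at h5
    omega
  rw [← pow_add]
  split_ifs with h
  · rw [h4] at h
    refine Even.neg_one_pow ?_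
    rw [Nat.even_iff]
    have hc : L = 0 ∨ L = 1 ∨ L = 2 ∨ L = 3 := by omega
    rcases hc with hc | hc | hc | hc <;> rw [hc] at h ⊢ <;> omega
  · rw [h4] at h
    refine Odd.neg_one_pow ?_
    rw [Nat.odd_iff]
    have hc : L = 0 ∨ L = 1 ∨ L = 2 ∨ L = 3 := by omega
    have hkc : k % 4 = 0 ∨ k % 4 = 1 ∨ k % 4 = 2 ∨ k % 4 = 3 := by omega
    rcases hc with hc | hc | hc | hc <;> rw [hc] at h h2 ⊢ <;> omega

end sign

end HGP


namespace HGP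

section goodops

variable {R : Type*} [CommRing R] {p l : ℕ}

theorem Good.lip {z g : ℕ → R} (hz : ∀ n k k', k ≡ k' [MOD p ^ n] → (p : R) ^ n ∣ z k - z k')
    (hg : Good p l z g) (n k k' : ℕ) (hk : k % p = l) (hk' : k' % p = l) (h : k ≡ k' [MOD p ^ n]) :
    (p : R) ^ n ∣ g k - g k' := by
  obtain ⟨Q, h1, h2⟩ := hg
  rw [h1 k hk, h1 k' hk']
  have := dvd_mul_sub_mul _ (hz n k k' h) (h2 n k k' hk hk' h)
  convert this using 1; ring

theorem Good.mul {z g g' : ℕ → R} (hz : ∀ n k k', k ≡ k' [MOD p ^ n] → (p : R) ^ n ∣ z k - z k')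
    (hg : Good p l z g) (hg' : Good p l z g') : Good p l z (fun k => g k * g' k) := by
  have hl := hg'.lip hz
  obtain ⟨Q, h1, h2⟩ := hg
  obtain ⟨Q', h1', h2'⟩ := hg'
  refine ⟨fun k => Q k * g' k + Q' k, ?_, ?_⟩
  · intro k hk
    show g k * g' k = 1 + z k * (Q k * g' k + Q' k)
    have e1 := h1 k hk
    have e2 := h1' k hk
    linear_combination g' k * e1 + e2
  · intro n k k' hk hk' h
    have := dvd_add (dvd_mul_sub_mul _ (h2 n k k' hk hk' h) (hl n k k' hk hk' h)) (h2' n k k' hk hk' h)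
    convert this using 1; ring

theorem Good.pow {z g : ℕ → R} (hz : ∀ n k k', k ≡ k' [MOD p ^ n] → (p : R) ^ n ∣ z k - z k')
    (hg : Good p l z g) (s : ℕ) : Good p l z (fun k => g k ^ s) := by
  induction s with
  | zero => exact ⟨fun _ => 0, by simp, by simp⟩
  | succ s ih =>
    have := ih.mul hz hg
    simpa only [pow_succ] using this

theorem Good.map {S : Type*} [CommRing S] (f : R →+* S) {z g : ℕ → R}
    (hg : Good p l z g) : Good p l (fun k => f (z k)) (fun k => f (g k)) := by
  obtain ⟨Q, h1, h2⟩ := hg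
  refine ⟨fun k => f (Q k), ?_, ?_⟩
  · intro k hk
    show f (g k) = 1 + f (z k) * f (Q k)
    rw [h1 k hk]; simp
  · intro n k k' hk hk' h
    have := map_dvd f (h2 n k k' hk hk' h)
    simpa using this

end goodops

theorem good_g (p : ℕ) [hp : Fact p.Prime] {a a' : ℤ_[p]} (ha : NotNonposInt p a)
    (h : IsDworkPrime p a a') :
    Good p (dl p a) (fun k => a + k)
      (fun k => (-1) ^ de p a * (-1) ^ (k + k / p) * (Psi p k).eval (a + k)) := by
  by_cases hp2 : p = 2
  · subst hp2
    obtain ⟨Q, h1, h2⟩ := good_psi_two ha (dl_lt 2 a) (by exact_mod_cast h)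
    refine ⟨Q, fun k hk => ?_, h2⟩
    rw [← h1 k hk]
    show _ = (if (4 : ℤ_[2]) ∣ a + k then 1 else -1) * (Psi 2 k).eval (a + k)
    rw [← sign_two a k hk]
  · obtain ⟨Q, h1, h2⟩ := good_psi_odd p hp2 ha (dl_lt p a) h
    refine ⟨Q, fun k hk => ?_, h2⟩
    rw [← h1 k hk]
    show (-1) ^ de p a * (-1) ^ (k + k / p) * (Psi p k).eval (a + k) = (Psi p k).eval (a + k)
    rw [sign_odd p hp2 a k hk, one_mul]

theorem exists_q (p : ℕ) [hp : Fact p.Prime] (s : ℕ) {a a' : ℤ_[p]} (ha : NotNonposInt p a)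
    (h : IsDworkPrime p a a') {A A1 : ℕ → ℤ_[p]} (hA : IsHGCoeff p s a A)
    (hA1 : IsHGCoeff p s a' A1)
    (u c : Wp p) (hc : c = 1 + (qq p : Wp p) * u)
    (cpw : ℤ_[p] → Wp p) (hcpw : IsCpow p c cpw)
    (B : ℕ → Wp p) (hB : IsBhat p s a a' A A1 cpw B) :
    ∃ q : ℕ → Wp p, (∀ k, B k = q k * iota p (A k)) ∧
      ∀ n k k', k ≡ k' [MOD p ^ n] → (p : Wp p) ^ n ∣ q k - q k' := by
  have hl := dl_lt p a
  set l := dl p a with hldef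
  have hpos := hp.out.pos
  have hz : ∀ n k k', k ≡ k' [MOD p ^ n] → (p : ℤ_[p]) ^ n ∣ (a + k) - (a + k') := by
    intro n k k' hk
    have := pow_dvd_of_modEq p (R := ℤ_[p]) hk
    simpa using this
  have hz' : ∀ n k k', k ≡ k' [MOD p ^ n] →
      (p : Wp p) ^ n ∣ iota p (a + k) - iota p (a + k') := by
    intro n k k' hk
    have := iota_pow_dvd p (hz n k k' hk)
    rwa [map_sub] at this
  have hdvd : ∀ k : ℕ, (p : ℤ_[p]) ∣ a + k ↔ k % p = l := dvd_add_iff p hl h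
  -- the G part
  have hg := good_g p ha h
  have hgu : ∀ k, k % p = l → IsUnit
      ((-1) ^ de p a * (-1) ^ (k + k / p) * (Psi p k).eval (a + k)) := by
    intro k hk
    have hu : IsUnit (-1 : ℤ_[p]) := isUnit_one.neg
    refine ((hu.pow _).mul (hu.pow _)).mul (not_dvd_isUnit p fun hd => ?_)
    rw [Psi_eval_RR] at hd
    have := dvd_sub hd (((hdvd k).2 hk).mul_right ((RR p k).eval (a + k)))
    simp only [add_sub_cancel_right] at this
    exact (isUnit_iff_not_dvd p).1 isUnit_one this
  set g : ℕ → ℤ_[p] := fun k => (-1) ^ de p a * (-1) ^ (k + k / p) * (Psi p k).eval (a + k) with hgdef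
  have hAg : ∀ k, k % p = l → A k = (-1) ^ (s * de p a) * A1 (k / p) * g k ^ s := by
    intro k hk
    have h1 := ratio_exact p hl h hA hA1 k
    rw [if_neg (by omega), mul_one, curly_reflect p ((hdvd k).2 hk)] at h1
    have hcu := (curly_isUnit p 1 k).pow s
    refine hcu.mul_left_cancel ?_
    rw [h1, hgdef]
    have h2 : ((-1 : ℤ_[p])) ^ (s * de p a) * ((-1) ^ de p a) ^ s = 1 := by
      rw [mul_comm s, pow_mul, ← mul_pow, ← mul_pow]; norm_num
    simp only [mul_pow]
    linear_combination (-A1 (k / p) * curly p 1 k ^ s * ((-1) ^ (k + k / p)) ^ s *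
      (Psi p k).eval (a + k) ^ s) * h2
  have hG := (hg.pow hz s).map (iota p)
  have hGlip := hG.lip hz'
  obtain ⟨QG, hG1, hG2⟩ := hG
  -- the C part
  obtain ⟨Qc, hc1, hc2⟩ := exists_Qc p u c hc cpw hcpw
  have hx : ∀ k, k % p = l → (p : ℤ_[p]) * (((k / p : ℕ) : ℤ_[p]) + a') = a + k := by
    intro k hk
    have h1 : (p : ℤ_[p]) * a' = a + l := h
    have h2 : k = p * (k / p) + l := by rw [← hk]; exact (Nat.div_add_mod k p).symm
    have h3 : (k : ℤ_[p]) = p * (k / p : ℕ) + l := by exact_mod_cast congrArg (Nat.cast : ℕ → ℤ_[p]) h2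
    linear_combination h1 - h3
  have hx0 : ∀ k, k % p = l → (((k / p : ℕ) : ℤ_[p]) + a') ≠ 0 := by
    intro k hk h0
    have := hx k hk
    rw [h0, mul_zero] at this
    exact ha k this.symm
  -- iv part
  refine ⟨fun k => if k % p = l then iota p (iv p (g k ^ s)) *
      (QG k - Qc (((k / p : ℕ) : ℤ_[p]) + a')) else iota p (iv p (a + k)), ?_, ?_⟩
  · intro k
    have hBk := hB k
    have hzk : (k : Wp p) + iota p a = iota p (a + k) := by simp [add_comm]
    rw [hzk] at hBk
    by_cases hk : k % p = l
    · beta_reduce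
      rw [if_pos hk]
      have hc' : dl p a ≤ k ∧ p ∣ (k - dl p a) := by
        rw [← hldef, ← hk]
        exact ⟨Nat.mod_le _ _, Nat.dvd_sub_mod k⟩
      have hq : (k - dl p a) / p = k / p := by
        rw [← hldef, ← hk]
        exact (Nat.div_eq_sub_mod_div).symm
      rw [if_pos hc', hq, hc1 _ (hx0 k hk)] at hBk
      have hxi := congrArg (iota p) (hx k hk)
      rw [map_mul, map_natCast] at hxi
      rw [hxi] at hBk
      have hAi := congrArg (iota p) (hAg k hk)
      have hgi := congrArg (iota p) (iv_mul p ((hgu k hk).pow s))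
      have hG1k : iota p (g k ^ s) = 1 + iota p (a + k) * QG k := hG1 k hk
      rw [show ((-1) ^ de p a * (-1) ^ (k + k / p) * (Psi p k).eval (a + k)) = g k from rfl] at hgi
      simp only [map_mul, map_pow, map_neg, map_one] at hAi hgi
      rw [map_pow] at hG1k
      have hne : iota p (a + k) ≠ 0 := fun h0 => ha k (iota_inj p (by simpa using h0))
      refine mul_left_cancel₀ hne ?_
      rw [hBk]
      set I := iota p (iv p (g k ^ s))
      set S := (-1 : Wp p) ^ (s * de p a) * iota p (A1 (k / p)) with hS
      set G := iota p (g k) ^ s with hGd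
      set z := iota p (a + k)
      set C := Qc (((k / p : ℕ) : ℤ_[p]) + a')
      rw [hAi]
      linear_combination S * hG1k - z * (QG k - C) * S * hgi
    · beta_reduce
      rw [if_neg hk]
      have hc' : ¬ (dl p a ≤ k ∧ p ∣ (k - dl p a)) := by
        rintro ⟨h1, h2⟩
        apply hk
        rw [← hldef] at h1 h2
        obtain ⟨m, hm⟩ := h2
        have : k = l + p * m := by omega
        rw [this, Nat.add_mul_mod_self_left, Nat.mod_eq_of_lt hl]
      rw [if_neg hc', sub_zero] at hBk
      have hu := not_dvd_isUnit p (mt (hdvd k).1 hk)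
      have h1 := congrArg (iota p) (iv_mul p hu)
      rw [map_mul, map_one] at h1
      rw [← hBk]
      linear_combination -B k * h1
  · intro n k k' hkk
    rcases n with _ | n
    · simp
    have hmod : k % p = k' % p := hkk.of_dvd (dvd_pow_self p (by omega))
    by_cases hk : k % p = l
    · have hk' : k' % p = l := hmod ▸ hk
      simp only [if_pos hk, if_pos hk']
      refine dvd_mul_sub_mul _ ?_ ?_
      · rw [← map_sub]
        refine iota_pow_dvd p (iv_congr p _ _ _ ?_)
        exact (hg.pow hz s).lip hz (n+1) k k' hk hk' hkk
      · have h1 := hG2 (n+1) k k' hk hk' hkk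
        have h2 := hc2 n _ _ (hx0 k hk) (hx0 k' hk') (by
          have h3 := hz (n+1) k k' hkk
          rw [← hx k hk, ← hx k' hk', ← mul_sub, pow_succ', mul_dvd_mul_iff_left (p_ne p)] at h3
          exact h3)
        have := dvd_sub h1 h2
        convert this using 1; ring
    · have hk' : ¬ k' % p = l := hmod ▸ hk
      simp only [if_neg hk, if_neg hk']
      rw [← map_sub]
      exact iota_pow_dvd p (iv_congr p _ _ _ (hz (n+1) k k' hkk))

end HGP


namespace HGP

section poly

theorem sum_range_mul' {M : Type*} [AddCommMonoid M] (f : ℕ → M) (m D : ℕ) :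
    ∑ i ∈ Finset.range (D * m), f i = ∑ d ∈ Finset.range D, ∑ j ∈ Finset.range m, f (d * m + j) := by
  induction D with
  | zero => simp
  | succ D ih => rw [add_mul, one_mul, Finset.sum_range_add, ih, Finset.sum_range_succ]

/-- truncated polynomial -/
noncomputable def PP {R : Type*} [CommRing R] (m : ℕ) (f : ℕ → R) : Polynomial R :=
  ∑ j ∈ Finset.range m, Polynomial.C (f j) * Polynomial.X ^ j

theorem PP_coeff {R : Type*} [CommRing R] (m : ℕ) (f : ℕ → R) (N : ℕ) :
    (PP m f).coeff N = if N < m then f N else 0 := by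
  simp [PP, Polynomial.coeff_C_mul, Polynomial.coeff_X_pow]

theorem trunc_eq {R : Type*} [CommRing R] (m : ℕ) (f : ℕ → R) :
    (PowerSeries.mk f).trunc m = PP m f := by
  ext N
  rw [PP_coeff, PowerSeries.coeff_trunc, PowerSeries.coeff_mk]

theorem PP_map {R S : Type*} [CommRing R] [CommRing S] (φ : R →+* S) (m : ℕ) (f : ℕ → R) :
    (PP m f).map φ = PP m (fun k => φ (f k)) := by
  ext N
  rw [Polynomial.coeff_map, PP_coeff, PP_coeff]
  split_ifs <;> simp

theorem PP_split {R : Type*} [CommRing R] (m D : ℕ) (f : ℕ → R) :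
    PP (D * m) f = ∑ d ∈ Finset.range D, Polynomial.X ^ (d * m) * PP m (fun j => f (d * m + j)) := by
  unfold PP
  rw [sum_range_mul']
  refine Finset.sum_congr rfl fun d _ => ?_
  rw [Finset.mul_sum]
  refine Finset.sum_congr rfl fun j _ => ?_
  ring

theorem PP_mul_coeff (p : ℕ) [hp : Fact p.Prime] {R : Type*} [CommRing R] (n : ℕ) (f g : ℕ → R) (N : ℕ) :
    (PP (p ^ n) f * PP (p ^ n) g).coeff N = ∑ j ∈ SS p n N, f j * g (N - j) := by
  rw [Polynomial.coeff_mul, Finset.Nat.sum_antidiagonal_eq_sum_range_succ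
    (fun i j => (PP (p ^ n) f).coeff i * (PP (p ^ n) g).coeff j)]
  simp only [PP_coeff]
  symm
  rw [show SS p n N = (Finset.range N.succ).filter (fun j => j < p ^ n ∧ N - j < p ^ n) by
    ext j; rw [mem_SS]; simp only [Finset.mem_filter, Finset.mem_range]; omega]
  rw [Finset.sum_filter]
  refine Finset.sum_congr rfl fun j _ => ?_
  by_cases h1 : j < p ^ n <;> by_cases h2 : N - j < p ^ n <;> simp [h1, h2]

theorem poly_congr (p : ℕ) [hp : Fact p.Prime] (AF ρ : ℕ → ℕ → ℤ_[p])
    (h1 : ∀ i k, AF i k = AF (i + 1) (k / p) * ρ i k)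
    (h2 : ∀ i n k k', n ≠ 0 → k ≡ k' [MOD p ^ n] → (p : ℤ_[p]) ^ n ∣ ρ i k - ρ i k')
    (B q : ℕ → Wp p) (hB : ∀ k, B k = q k * iota p (AF 0 k))
    (hq : ∀ n k k', k ≡ k' [MOD p ^ n] → (p : Wp p) ^ n ∣ q k - q k') (n : ℕ) :
    Polynomial.C ((p : Wp p) ^ n) ∣ PP (p ^ (n+1)) B * PP (p ^ n) (fun k => iota p (AF 0 k)) -
      PP (p ^ n) B * PP (p ^ (n+1)) (fun k => iota p (AF 0 k)) := by
  rw [pow_succ', PP_split, PP_split (p ^ n) p (fun k => iota p (AF 0 k)), Finset.sum_mul,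
    Finset.mul_sum, ← Finset.sum_sub_distrib]
  refine Finset.dvd_sum fun d _ => ?_
  have key : Polynomial.C ((p : Wp p) ^ n) ∣
      PP (p ^ n) (fun j => B (d * p ^ n + j)) * PP (p ^ n) (fun k => iota p (AF 0 k)) -
      PP (p ^ n) B * PP (p ^ n) (fun j => iota p (AF 0 (d * p ^ n + j))) := by
    rw [Polynomial.C_dvd_iff_dvd_coeff]
    intro N
    rw [Polynomial.coeff_sub, PP_mul_coeff, PP_mul_coeff, ← Finset.sum_sub_distrib]
    have e1 : (p : Wp p) ^ n ∣ ∑ j ∈ SS p n N, (B (d * p ^ n + j) * iota p (AF 0 (N - j)) -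
        B j * iota p (AF 0 (d * p ^ n + (N - j)))) - ∑ j ∈ SS p n N, q j * iota p (gg p (AF 0) n d N j) := by
      rw [← Finset.sum_sub_distrib]
      refine Finset.dvd_sum fun j _ => ?_
      obtain ⟨w, hw⟩ := hq n (d * p ^ n + j) j (by
        unfold Nat.ModEq; rw [add_comm, Nat.add_mul_mod_self_right])
      refine ⟨w * iota p (AF 0 (d * p ^ n + j)) * iota p (AF 0 (N - j)), ?_⟩
      rw [hB, hB, gg, map_sub, map_mul, map_mul]
      linear_combination iota p (AF 0 (d * p ^ n + j)) * iota p (AF 0 (N - j)) * hw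
    have e2 : (p : Wp p) ^ n ∣ ∑ j ∈ SS p n N, q j * iota p (gg p (AF 0) n d N j) := by
      rcases (SS p n N).eq_empty_or_nonempty with h0 | ⟨κ, hκ⟩
      · rw [h0]; simp
      · have ht := telescope (p : Wp p) p n 0 (SS p n N) (fun j => iota p (gg p (AF 0) n d N j)) q
          (fun j _ j' _ t htt => hq t j j' htt) 0 (Nat.zero_le _) (fun k' _ hk' κ' => by
            have := iota_pow_dvd p (dwork p AF ρ h1 h2 n 0 N d k' κ' hk')
            rwa [map_sum] at this) κ hκ
        have hall : (SS p n N).filter (fun j => j % p ^ 0 = κ % p ^ 0) = SS p n N := by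
          refine Finset.filter_true_of_mem fun j _ => ?_
          simp [Nat.mod_one]
        rw [hall, add_zero] at ht
        simp only [sub_mul] at ht
        rw [Finset.sum_sub_distrib, ← Finset.mul_sum, ← map_sum, gg_total, map_zero, mul_zero,
          sub_zero] at ht
        exact ht
    have := dvd_add e1 e2
    simpa using this
  obtain ⟨w, hw⟩ := key
  exact ⟨Polynomial.X ^ (d * p ^ n) * w, by linear_combination Polynomial.X ^ (d * p ^ n) * hw⟩

end poly

section units

variable (p : ℕ) [hp : Fact p.Prime]

theorem toZMod_eq_zero_iff (x : ℤ_[p]) : PadicInt.toZMod x = 0 ↔ (p : ℤ_[p]) ∣ x := by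
  rw [← RingHom.mem_ker, PadicInt.ker_toZMod, PadicInt.maximalIdeal_eq_span_p,
    Ideal.mem_span_singleton]

theorem lucas (A A1 ρ : ℕ → ℤ_[p]) (h1 : ∀ k, A k = A1 (k / p) * ρ k)
    (h2 : ∀ n k k', n ≠ 0 → k ≡ k' [MOD p ^ n] → (p : ℤ_[p]) ^ n ∣ ρ k - ρ k')
    (h0 : A1 0 = 1) (n : ℕ) :
    PP (p ^ (n+1)) (fun k => PadicInt.toZMod (A k)) =
      PP p (fun k => PadicInt.toZMod (A k)) * PP (p ^ n) (fun k => PadicInt.toZMod (A1 k)) ^ p := by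
  rw [← ZMod.expand_card, pow_succ, PP_split]
  have e : Polynomial.expand (ZMod p) p (PP (p ^ n) (fun k => PadicInt.toZMod (A1 k))) =
      ∑ d ∈ Finset.range (p ^ n), Polynomial.C (PadicInt.toZMod (A1 d)) * Polynomial.X ^ (d * p) := by
    unfold PP
    rw [map_sum]
    refine Finset.sum_congr rfl fun d _ => ?_
    rw [map_mul, Polynomial.expand_C, map_pow, Polynomial.expand_X, ← pow_mul, mul_comm p]
  rw [e, Finset.mul_sum]
  refine Finset.sum_congr rfl fun d _ => ?_
  have e2 : PP p (fun j => PadicInt.toZMod (A (d * p + j))) =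
      Polynomial.C (PadicInt.toZMod (A1 d)) * PP p (fun k => PadicInt.toZMod (A k)) := by
    unfold PP
    rw [Finset.mul_sum]
    refine Finset.sum_congr rfl fun j hj => ?_
    rw [Finset.mem_range] at hj
    have e3 : PadicInt.toZMod (A (d * p + j)) = PadicInt.toZMod (A1 d) * PadicInt.toZMod (A j) := by
      rw [← map_mul, ← sub_eq_zero, ← map_sub, toZMod_eq_zero_iff, h1, h1 j, Nat.div_eq_of_lt hj, h0,
        one_mul, add_comm, Nat.add_mul_div_right _ _ hp.out.pos, Nat.div_eq_of_lt hj, zero_add,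
        ← mul_sub]
      have := h2 1 (j + d * p) j one_ne_zero (by
        unfold Nat.ModEq; rw [pow_one, Nat.add_mul_mod_self_right])
      rw [pow_one] at this
      exact this.mul_left _
    beta_reduce
    rw [e3, map_mul, mul_assoc]
  rw [e2]; ring

theorem dvd_hpow (AF ρ : ℕ → ℕ → ℤ_[p])
    (h1 : ∀ i k, AF i k = AF (i + 1) (k / p) * ρ i k)
    (h2 : ∀ i n k k', n ≠ 0 → k ≡ k' [MOD p ^ n] → (p : ℤ_[p]) ^ n ∣ ρ i k - ρ i k')
    (h0 : ∀ i, AF i 0 = 1) (hb : Polynomial (ZMod p))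
    (hh : ∀ i, PP p (fun k => PadicInt.toZMod (AF i k)) ∣ hb) (n : ℕ) :
    ∀ i, ∃ M, PP (p ^ n) (fun k => PadicInt.toZMod (AF i k)) ∣ hb ^ M := by
  induction n with
  | zero =>
    intro i
    refine ⟨0, ?_⟩
    simp [PP, h0]
  | succ n ih =>
    intro i
    obtain ⟨M, hM⟩ := ih (i+1)
    refine ⟨1 + M * p, ?_⟩
    rw [lucas p (AF i) (AF (i+1)) (ρ i) (h1 i) (h2 i) (h0 (i+1)), pow_add, pow_one, pow_mul]
    exact mul_dvd_mul (hh i) (pow_dvd_pow_of_dvd hM p)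

theorem lift_dvd (F h : Polynomial ℤ_[p]) (M : ℕ)
    (hd : F.map PadicInt.toZMod ∣ (h.map (PadicInt.toZMod (p := p))) ^ M) :
    ∃ g w : Polynomial ℤ_[p], h ^ M = F * g + (p : Polynomial ℤ_[p]) * w := by
  obtain ⟨gb, hgb⟩ := hd
  obtain ⟨g, rfl⟩ := Polynomial.map_surjective (PadicInt.toZMod (p := p))
    (ZMod.ringHom_surjective _) gb
  have : Polynomial.C (p : ℤ_[p]) ∣ h ^ M - F * g := by
    rw [Polynomial.C_dvd_iff_dvd_coeff]
    intro i
    rw [← toZMod_eq_zero_iff, ← Polynomial.coeff_map, Polynomial.map_sub, Polynomial.map_pow,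
      Polynomial.map_mul, hgb, sub_self, Polynomial.coeff_zero]
  obtain ⟨w, hw⟩ := this
  refine ⟨g, w, ?_⟩
  rw [map_natCast] at hw
  linear_combination hw

theorem periodic_as (as : ℕ → ℤ_[p]) (hasD : ∀ i, IsDworkPrime p (as i) (as (i + 1)))
    (r : ℕ) (har : as r = as 0) (i : ℕ) : as (i + r) = as i := by
  induction i with
  | zero => simpa using har
  | succ i ih =>
    have h1 := hasD i
    have h2 := hasD (i + r)
    unfold IsDworkPrime at h1 h2
    rw [ih, ← h1] at h2
    rw [show i + 1 + r = i + r + 1 by ring]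
    exact mul_left_cancel₀ (p_ne p) h2

theorem p_pow_Rn (h : Polynomial (Wp p)) (n : ℕ) (x : Wp p) :
    toRn p h n (Polynomial.C ((p : Wp p) ^ n * x)) = 0 := by
  have : (Ideal.Quotient.mk (Ideal.span {(p : Wp p) ^ n})) ((p : Wp p) ^ n * x) = 0 := by
    rw [Ideal.Quotient.eq_zero_iff_mem, Ideal.mem_span_singleton]
    exact dvd_mul_right _ _
  have h2 : laurentOfPolyW p n (Polynomial.C ((p : Wp p) ^ n * x)) = 0 := by
    unfold laurentOfPolyW
    rw [RingHom.comp_apply, Polynomial.coe_mapRingHom, Polynomial.map_C, this, map_zero, map_zero]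
  rw [toRn, RingHom.comp_apply, h2, map_zero]

theorem p_pow_Rn' (h : Polynomial (Wp p)) (n : ℕ) : (p : Rn p h n) ^ n = 0 := by
  have := p_pow_Rn p h n 1
  rw [mul_one] at this
  simpa using this

theorem toRn_unit (h : Polynomial (Wp p)) (n : ℕ) : IsUnit (toRn p h n h) :=
  IsLocalization.Away.algebraMap_isUnit (S := Rn p h n) (laurentOfPolyW p n h)

theorem unit_of_lift (F h : Polynomial ℤ_[p]) (M : ℕ) (g w : Polynomial ℤ_[p])
    (hh : h ^ M = F * g + (p : Polynomial ℤ_[p]) * w) (n : ℕ) :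
    IsUnit (toRn p (h.map (iota p)) n (F.map (iota p))) := by
  have h1 := congrArg (fun f => toRn p (h.map (iota p)) n (f.map (iota p))) hh
  simp only [Polynomial.map_pow, Polynomial.map_add, Polynomial.map_mul, Polynomial.map_natCast,
    map_pow, map_add, map_mul, map_natCast] at h1
  have hu := (toRn_unit p (h.map (iota p)) n).pow M
  set φ := toRn p (h.map (iota p)) n
  have hnil : IsNilpotent (-((p : Rn p (h.map (iota p)) n) * φ (w.map (iota p)))) := by
    refine ⟨n, ?_⟩
    rw [neg_pow, mul_pow, p_pow_Rn']; simp
  have h2 : IsUnit (φ (F.map (iota p)) * φ (g.map (iota p))) := by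
    have h3 := hnil.isUnit_add_left_of_commute hu (Commute.all _ _)
    rw [h1] at h3
    rwa [add_assoc, add_neg_cancel, add_zero] at h3
  exact isUnit_of_mul_isUnit_left h2

end units

end HGP


namespace HGP

theorem cancel_inverse {R S : Type*} [CommRing R] [CommRing S] (ρ : R →+* S) (x y : R) (x' y' : S)
    (hy : IsUnit y) (hy' : IsUnit y') (h : ρ x * y' = x' * ρ y) :
    ρ (x * Ring.inverse y) = x' * Ring.inverse y' := by
  have e1 : Ring.inverse y * y = 1 := Ring.inverse_mul_cancel _ hy
  have e2 : Ring.inverse y' * y' = 1 := Ring.inverse_mul_cancel _ hy'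
  have e3 : ρ (Ring.inverse y) * ρ y = 1 := by rw [← map_mul, e1, map_one]
  rw [map_mul]
  linear_combination ρ (Ring.inverse y) * Ring.inverse y' * h
    - ρ x * ρ (Ring.inverse y) * e2 + x' * Ring.inverse y' * e3

/-- if `a^{(r)} = a`, then with `h(t) = Π_{i<r} F_{a^{(i)},…,a^{(i)}}(t)_{<p}`,
the image of `F_{a,…,a}(t)_{<p^n}` in `R_n = (W/p^n)[t,t⁻¹,h(t)⁻¹]` is a unit for every `n ≥ 1`,
and the elements `Ĝ^{(σ)}_{a,…,a}(t)_{<p^n} · (F_{a,…,a}(t)_{<p^n})⁻¹ ∈ R_n` are compatible under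
the reduction maps `R_{n+1} → R_n`, hence define an element of `W⟨t,t⁻¹,h(t)⁻¹⟩ = lim← R_n`. -/
theorem statement4 (p : ℕ) [Fact p.Prime] (s : ℕ) (hs : 1 ≤ s)
    (a : ℤ_[p]) (ha : NotNonposInt p a)
    (as : ℕ → ℤ_[p]) (has0 : as 0 = a) (hasD : ∀ i, IsDworkPrime p (as i) (as (i + 1)))
    (r : ℕ) (hr : 1 ≤ r) (har : as r = a)
    (AF : ℕ → ℕ → ℤ_[p]) (hAF : ∀ i, IsHGCoeff p s (as i) (AF i))
    (u c : Wp p) (hc : c = 1 + (qq p : Wp p) * u)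
    (cpw : ℤ_[p] → Wp p) (hcpw : IsCpow p c cpw)
    (B : ℕ → Wp p) (hB : IsBhat p s a (as 1) (AF 0) (AF 1) cpw B)
    (hW : Polynomial (Wp p))
    (hhW : hW = (∏ i ∈ Finset.range r, (PowerSeries.mk (AF i)).trunc p).map (iota p)) :
    (∀ n : ℕ, 1 ≤ n →
      IsUnit (toRn p hW n ((PowerSeries.mk (fun k => iota p (AF 0 k))).trunc (p ^ n)))) ∧
    (∀ ρ : (∀ n : ℕ, Rn p hW (n + 1) →+* Rn p hW n),
      (∀ (n : ℕ) (f : Polynomial (Wp p)), ρ n (toRn p hW (n + 1) f) = toRn p hW n f) →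
      (∀ n : ℕ, ρ n (mkRn p hW (n + 1) (LaurentPolynomial.T (-1))) =
        mkRn p hW n (LaurentPolynomial.T (-1))) →
      ∀ n : ℕ,
        ρ n (toRn p hW (n + 1) ((PowerSeries.mk B).trunc (p ^ (n + 1))) *
            Ring.inverse (toRn p hW (n + 1)
              ((PowerSeries.mk (fun k => iota p (AF 0 k))).trunc (p ^ (n + 1))))) =
          toRn p hW n ((PowerSeries.mk B).trunc (p ^ n)) *
            Ring.inverse (toRn p hW n
              ((PowerSeries.mk (fun k => iota p (AF 0 k))).trunc (p ^ n)))) := by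
  subst has0
  choose ρ h1 h2 using fun i => ratio p (dl_lt p (as i)) (hasD i) (hAF i) (hAF (i+1))
  have h0 : ∀ i, AF i 0 = 1 := by
    intro i
    have := hAF i 0
    simpa using this
  have hper : Function.Periodic AF r := by
    intro i
    have h := hAF (i + r)
    rw [periodic_as p as hasD r har i] at h
    exact coeff_unique p h (hAF i)
  obtain ⟨h, hh⟩ : ∃ h, h = ∏ i ∈ Finset.range r, (PowerSeries.mk (AF i)).trunc p := ⟨_, rfl⟩
  rw [← hh] at hhW
  subst hhW
  have hdv : ∀ i, PP p (fun k => PadicInt.toZMod (AF i k)) ∣ h.map (PadicInt.toZMod (p := p)) := by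
    intro i
    rw [← PP_map]
    refine Polynomial.map_dvd _ ?_
    rw [← hper.map_mod_nat i, hh]
    have := Finset.dvd_prod_of_mem (fun i => (PowerSeries.mk (AF i)).trunc p)
      (Finset.mem_range.2 (Nat.mod_lt i hr))
    beta_reduce at this
    rw [trunc_eq] at this
    exact this
  have hU : ∀ m n : ℕ, IsUnit (toRn p (h.map (iota p)) n
      ((PowerSeries.mk (fun k => iota p (AF 0 k))).trunc (p ^ m))) := by
    intro m n
    obtain ⟨M, hM⟩ := dvd_hpow p AF ρ h1 h2 h0 _ hdv m 0
    rw [← PP_map] at hM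
    obtain ⟨g, w, hg⟩ := lift_dvd p _ h M hM
    rw [trunc_eq, ← PP_map]
    exact unit_of_lift p _ h M g w hg n
  refine ⟨fun n _ => hU n n, ?_⟩
  intro σ hσ _ n
  obtain ⟨q, hBq, hq⟩ := exists_q p s ha (hasD 0) (hAF 0) (hAF 1) u c hc cpw hcpw B hB
  refine cancel_inverse (σ n) _ _ _ _ (hU _ _) (hU _ _) ?_
  rw [hσ, hσ]
  obtain ⟨w, hw⟩ := poly_congr p AF ρ h1 h2 B q hBq hq n
  simp only [trunc_eq]
  rw [← sub_eq_zero, ← map_mul, ← map_mul, ← map_sub, hw, map_mul]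
  have := p_pow_Rn p (h.map (iota p)) n 1
  rw [mul_one] at this
  rw [this, zero_mul]

end HGP
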